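/- arXiv:1002.3197 — 2 statements merged into one kernel-verified Lean document; each statement's English description precedes it below -/
import Mathlib

section
/- Let {ω^t}_{t∈[0,1]} be a family of weights on the circle 𝕋 such that (i) (t,x) ↦ ω^t(x) is jointly measurable, (ii) ∫₀¹∫₀¹ |log ω^t(x)| dx dt < ∞, and (iii) each ω^t belongs to A_∞^d(𝕋) with A_∞^d(ω^t) ≤ V for a constant V independent of t. Then the geometric-arithmetic average Ω(x) := exp(∫₀¹ log ω^t(x+t) dt) belongs to A_∞(𝕋), with A_∞(Ω) bounded by a constant depending only on V. -/
open MeasureTheory Real Set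

noncomputable section

/-- The average of `f` over the interval `[a, a + ℓ]`. -/
def avgT (f : ℝ → ℝ) (a ℓ : ℝ) : ℝ := (1 / ℓ) * ∫ x in a..(a + ℓ), f x

/-- An interval of the circle `𝕋 = [0,1]`, given by its left endpoint `a` (a real number,
read modulo 1) and its length `ℓ`. -/
def IsIntervalT (a ℓ : ℝ) : Prop := 0 < ℓ ∧ ℓ ≤ 1

/-- The dyadic intervals of the circle `𝕋 = [0,1]`: the whole circle `[0,1]` together with
the intervals `[j·2⁻ᵏ, (j+1)·2⁻ᵏ)` for `k ≥ 1`, `0 ≤ j < 2ᵏ`. -/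
def IsDyadicT (a ℓ : ℝ) : Prop :=
  (a = 0 ∧ ℓ = 1) ∨
    ∃ k j : ℕ, 1 ≤ k ∧ j < 2 ^ k ∧ a = (j : ℝ) / 2 ^ k ∧ ℓ = 1 / 2 ^ k

/-- The `A_p` quantity `(⨍_Q ω)·(⨍_Q ω^{-1/(p-1)})^{p-1}` of `ω` over the interval
`[a, a+ℓ]`. -/
def ApQ (p : ℝ) (ω : ℝ → ℝ) (a ℓ : ℝ) : ℝ :=
  avgT ω a ℓ * (avgT (fun x => ω x ^ (-(1 / (p - 1)))) a ℓ) ^ (p - 1)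

/-- The `A_1` quantity `(⨍_Q ω)/(ess inf_Q ω)`. -/
def A1Q (ω : ℝ → ℝ) (a ℓ : ℝ) : ℝ :=
  avgT ω a ℓ / essInf ω (volume.restrict (Set.Ioo a (a + ℓ)))

/-- The `A_∞` quantity `(⨍_Q ω)·exp(⨍_Q log(1/ω))`. -/
def AinfQ (ω : ℝ → ℝ) (a ℓ : ℝ) : ℝ :=
  avgT ω a ℓ * Real.exp (avgT (fun x => Real.log (1 / ω x)) a ℓ)

/-- The `RH_p` quantity `(⨍_Q ω^p)^{1/p}·(⨍_Q ω)⁻¹`. -/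
def RHpQ (p : ℝ) (ω : ℝ → ℝ) (a ℓ : ℝ) : ℝ :=
  (avgT (fun x => ω x ^ p) a ℓ) ^ (1 / p) * (avgT ω a ℓ)⁻¹

/-- The `RH_∞` quantity `(ess sup_Q ω)·(⨍_Q ω)⁻¹`. -/
def RHinfQ (ω : ℝ → ℝ) (a ℓ : ℝ) : ℝ :=
  essSup ω (volume.restrict (Set.Ioo a (a + ℓ))) * (avgT ω a ℓ)⁻¹

/-- `ω` is a doubling weight with constant `C`: the mass of the double `Q̃` of any interval
`Q` of the circle is at most `C` times the mass of `Q`. -/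
def DoublingT (ω : ℝ → ℝ) (C : ℝ) : Prop :=
  ∀ a ℓ : ℝ, IsIntervalT a ℓ →
    (∫ x in (a - ℓ / 2)..(a + ℓ + ℓ / 2), ω x) ≤ C * ∫ x in a..(a + ℓ), ω x

/-- `ω` is dyadic doubling with constant `C`: the mass of the dyadic parent of any dyadic
interval `I = [j·2⁻ᵏ, (j+1)·2⁻ᵏ)` is at most `C` times the mass of `I`. -/
def DyadicDoublingT (ω : ℝ → ℝ) (C : ℝ) : Prop :=
  ∀ k j : ℕ, 1 ≤ k → j < 2 ^ k →
    (∫ x in (((2 * (j / 2) : ℕ) : ℝ) / 2 ^ k)..((((2 * (j / 2) : ℕ) : ℝ) / 2 ^ k) + 2 / 2 ^ k),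
        ω x)
      ≤ C * ∫ x in ((j : ℝ) / 2 ^ k)..(((j : ℝ) / 2 ^ k) + 1 / 2 ^ k), ω x

/-- The geometric-arithmetic average `Ω(x) = exp(∫₀¹ log ω^t(x+t) dt)`. -/
def gaAvg (ω : ℝ → ℝ → ℝ) (x : ℝ) : ℝ :=
  Real.exp (∫ t in (0:ℝ)..1, Real.log (ω t (x + t)))

/-- The logarithm `φ(x) = ∫₀¹ log ω^t(x+t) dt` of the geometric-arithmetic average. -/
def gaLog (ω : ℝ → ℝ → ℝ) (x : ℝ) : ℝ :=
  ∫ t in (0:ℝ)..1, Real.log (ω t (x + t))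

/-- The translation average `ω(x) = ∫₀¹ ω^t(x+t) dt`. -/
def trAvg (ω : ℝ → ℝ → ℝ) (x : ℝ) : ℝ :=
  ∫ t in (0:ℝ)..1, ω t (x + t)

/-- The Haar function of the interval `[a, a+ℓ)`. -/
def haarT (a ℓ x : ℝ) : ℝ :=
  if a ≤ x ∧ x < a + ℓ / 2 then 1 / Real.sqrt ℓ
  else if a + ℓ / 2 ≤ x ∧ x < a + ℓ then -(1 / Real.sqrt ℓ)
  else 0

/-- The Haar coefficient `(f, h_I)` of `f` on the interval `I = [a, a+ℓ)`. -/
def haarCoef (f : ℝ → ℝ) (a ℓ : ℝ) : ℝ :=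
  ∫ x in a..(a + ℓ), f x * haarT a ℓ x

/-- The small-scale part `φ_A(x) = ∫₀¹ Σ_{J∈𝒟, |J|<L} (φ^t, h_J) h_J(x+t) dt` of the
translation-averaged Haar expansion, relative to the scale `L`. -/
def phiA (φ : ℝ → ℝ → ℝ) (L x : ℝ) : ℝ :=
  ∫ t in (0:ℝ)..1, ∑' n : ℕ,
    (if (1 : ℝ) / 2 ^ n < L then
      ∑ j ∈ Finset.range (2 ^ n),
        haarCoef (φ t) ((j : ℝ) / 2 ^ n) (1 / 2 ^ n) *
          haarT ((j : ℝ) / 2 ^ n) (1 / 2 ^ n) (Int.fract (x + t))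
    else 0)

/-- The large-scale part `φ_B(x) = ∫₀¹ Σ_{J∈𝒟, |J|≥L} (φ^t, h_J) h_J(x+t) dt`. -/
def phiB (φ : ℝ → ℝ → ℝ) (L x : ℝ) : ℝ :=
  ∫ t in (0:ℝ)..1, ∑' n : ℕ,
    (if L ≤ (1 : ℝ) / 2 ^ n then
      ∑ j ∈ Finset.range (2 ^ n),
        haarCoef (φ t) ((j : ℝ) / 2 ^ n) (1 / 2 ^ n) *
          haarT ((j : ℝ) / 2 ^ n) (1 / 2 ^ n) (Int.fract (x + t))
    else 0)

/-- The average of `f` over a rectangle `[a,a+ℓ]×[b,b+m]` in the product circle `𝕋⊗𝕋`. -/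
def avg2 (f : ℝ → ℝ → ℝ) (a ℓ b m : ℝ) : ℝ :=
  (1 / (ℓ * m)) * ∫ x in a..(a + ℓ), ∫ y in b..(b + m), f x y

/-- The product `A_p` quantity of `f` over a rectangle in `𝕋⊗𝕋`. -/
def Ap2Q (p : ℝ) (f : ℝ → ℝ → ℝ) (a ℓ b m : ℝ) : ℝ :=
  avg2 f a ℓ b m * (avg2 (fun x y => f x y ^ (-(1 / (p - 1)))) a ℓ b m) ^ (p - 1)

end

/-- The average of `f` over the dyadic interval of length `2⁻ⁿ` containing `x`. -/
noncomputable def dyadicAvg (n : ℕ) (f : ℝ → ℝ) (x : ℝ) : ℝ :=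
  avgT f ((⌊2 ^ n * x⌋ : ℝ) / 2 ^ n) (1 / 2 ^ n)

theorem avgT_add_intCast {f : ℝ → ℝ} (hf : Function.Periodic f 1) (a ℓ : ℝ) (k : ℤ) :
    avgT f (a + k) ℓ = avgT f a ℓ := by
  have hk : ∀ x, f (x + k) = f x := fun x => by simpa using hf.int_mul k x
  unfold avgT
  congr 1
  have h := intervalIntegral.integral_comp_add_right (a := a) (b := a + ℓ) f (k : ℝ)
  simp only [hk] at h
  rw [h]
  congr 1
  ring

/-- A dyadic bound on `𝕋` holds for all dyadic intervals of the line, by periodicity. -/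
theorem AinfQ_dyadic_le {w : ℝ → ℝ} {V : ℝ} (hper : Function.Periodic w 1)
    (hV : ∀ a ℓ : ℝ, IsDyadicT a ℓ → AinfQ w a ℓ ≤ V) (n : ℕ) (j : ℤ) :
    AinfQ w ((j : ℝ) / 2 ^ n) (1 / 2 ^ n) ≤ V := by
  have hlog : Function.Periodic (fun x => Real.log (1 / w x)) 1 := fun x => by
    simp only [hper x]
  have h2 : (0 : ℤ) < 2 ^ n := by positivity
  have hj : (j : ℝ) / 2 ^ n = ((j % 2 ^ n).toNat : ℝ) / 2 ^ n + ((j / 2 ^ n : ℤ) : ℝ) := by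
    have h1 : (((j % 2 ^ n).toNat : ℤ) : ℝ) = ((j % 2 ^ n : ℤ) : ℝ) := by
      rw [Int.toNat_of_nonneg (Int.emod_nonneg _ h2.ne')]
    have h3 : ((j % 2 ^ n + 2 ^ n * (j / 2 ^ n) : ℤ) : ℝ) = (j : ℝ) := by
      rw [Int.emod_add_mul_ediv]
    rw [Int.cast_natCast] at h1
    rw [h1, ← h3]
    push_cast
    field_simp
  have hd : IsDyadicT (((j % 2 ^ n).toNat : ℝ) / 2 ^ n) (1 / 2 ^ n) := by
    rcases Nat.eq_zero_or_pos n with rfl | hn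
    · left; simp
    · refine Or.inr ⟨n, (j % 2 ^ n).toNat, hn, ?_, rfl, rfl⟩
      have h3 := Int.emod_lt_of_pos j h2
      have h4 := Int.emod_nonneg j h2.ne'
      zify
      rw [Int.toNat_of_nonneg h4]
      exact h3
  rw [hj]
  unfold AinfQ
  rw [avgT_add_intCast hper, avgT_add_intCast hlog]
  exact hV _ _ hd

/-- The exponential of the mean oscillation is controlled by the `A_∞` quantity. -/
theorem integral_exp_sub_avgT_le {w : ℝ → ℝ} {V a ℓ : ℝ} (hw : ∀ x, 0 < w x) (hℓ : 0 < ℓ)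
    (hV : AinfQ w a ℓ ≤ V) :
    ∫ x in a..(a + ℓ), Real.exp (Real.log (w x) - avgT (fun y => Real.log (w y)) a ℓ)
      ≤ V * ℓ := by
  have h1 : ∀ x, Real.exp (Real.log (w x) - avgT (fun y => Real.log (w y)) a ℓ)
      = w x * Real.exp (-avgT (fun y => Real.log (w y)) a ℓ) := fun x => by
    rw [sub_eq_add_neg, Real.exp_add, Real.exp_log (hw x)]
  have h2 : avgT (fun x => Real.log (1 / w x)) a ℓ = -avgT (fun y => Real.log (w y)) a ℓ := by
    simp [avgT]
  simp only [h1, intervalIntegral.integral_mul_const]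
  rw [AinfQ, h2] at hV
  unfold avgT at hV ⊢
  calc _ = ((1 / ℓ * ∫ x in a..(a + ℓ), w x) *
        Real.exp (-(1 / ℓ * ∫ x in a..(a + ℓ), Real.log (w x)))) * ℓ := by field_simp
    _ ≤ _ := by gcongr

theorem integral_abs_sub_avgT_le {f : ℝ → ℝ} {V a ℓ : ℝ} (hℓ : 0 < ℓ)
    (hf : IntervalIntegrable f volume a (a + ℓ))
    (he : IntervalIntegrable (fun x => Real.exp (f x - avgT f a ℓ)) volume a (a + ℓ))
    (hV : ∫ x in a..(a + ℓ), Real.exp (f x - avgT f a ℓ) ≤ V * ℓ) :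
    ∫ x in a..(a + ℓ), |f x - avgT f a ℓ| ≤ 2 * V * ℓ := by
  have hD : IntervalIntegrable (fun x => f x - avgT f a ℓ) volume a (a + ℓ) :=
    hf.sub intervalIntegrable_const
  have h0 : ∫ x in a..(a + ℓ), (f x - avgT f a ℓ) = 0 := by
    rw [intervalIntegral.integral_sub hf intervalIntegrable_const]
    simp [avgT]
    field_simp
    simp
  calc ∫ x in a..(a + ℓ), |f x - avgT f a ℓ|
      ≤ ∫ x in a..(a + ℓ), (2 * Real.exp (f x - avgT f a ℓ) - (f x - avgT f a ℓ)) := by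
        refine intervalIntegral.integral_mono_on (by linarith) hD.abs
          ((he.const_mul 2).sub hD) fun x _ => ?_
        have h1 := Real.add_one_le_exp (f x - avgT f a ℓ)
        have h2 := Real.exp_pos (f x - avgT f a ℓ)
        rcases abs_cases (f x - avgT f a ℓ) with h | h <;> linarith
    _ = 2 * ∫ x in a..(a + ℓ), Real.exp (f x - avgT f a ℓ) := by
        rw [intervalIntegral.integral_sub (he.const_mul 2) hD, h0,
          intervalIntegral.integral_const_mul, sub_zero]
    _ ≤ _ := by linarith

/-- Averages over an interval and a subinterval of half the length differ by a bounded amount. -/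
theorem abs_avgT_sub_avgT_le {f : ℝ → ℝ} {V a ℓ b h : ℝ} (hh : 0 < h) (hℓ : ℓ = 2 * h)
    (hab : a ≤ b) (hba : b + h ≤ a + ℓ) (hf : IntervalIntegrable f volume a (a + ℓ))
    (hV : ∫ x in a..(a + ℓ), |f x - avgT f a ℓ| ≤ V * ℓ) :
    |avgT f b h - avgT f a ℓ| ≤ 2 * V := by
  have hsub : Set.uIcc b (b + h) ⊆ Set.uIcc a (a + ℓ) := by
    rw [Set.uIcc_of_le (by linarith), Set.uIcc_of_le (by linarith)]
    exact Set.Icc_subset_Icc hab hba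
  have hf' : IntervalIntegrable f volume b (b + h) := hf.mono_set hsub
  have hD : IntervalIntegrable (fun x => f x - avgT f a ℓ) volume a (a + ℓ) :=
    hf.sub intervalIntegrable_const
  have h1 : avgT f b h - avgT f a ℓ = 1 / h * ∫ x in b..(b + h), (f x - avgT f a ℓ) := by
    rw [intervalIntegral.integral_sub hf' intervalIntegrable_const]
    simp only [intervalIntegral.integral_const, smul_eq_mul, add_sub_cancel_left, mul_sub]
    rw [← mul_assoc, one_div_mul_cancel hh.ne', one_mul, avgT]
  have h2 : |∫ x in b..(b + h), (f x - avgT f a ℓ)| ≤ V * ℓ :=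
    calc _ ≤ ∫ x in b..(b + h), |f x - avgT f a ℓ| :=
          intervalIntegral.abs_integral_le_integral_abs (by linarith)
      _ ≤ ∫ x in a..(a + ℓ), |f x - avgT f a ℓ| :=
          intervalIntegral.integral_mono_interval hab (by linarith) hba
            (Filter.Eventually.of_forall fun x => abs_nonneg _) hD.abs
      _ ≤ _ := hV
  rw [h1, abs_mul, abs_of_pos (by positivity)]
  calc 1 / h * |∫ x in b..(b + h), (f x - avgT f a ℓ)| ≤ 1 / h * (V * ℓ) := by gcongr
    _ = 2 * V := by rw [hℓ]; field_simp

theorem floor_two_pow_mul_eq {n : ℕ} {j : ℤ} {x : ℝ}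
    (hx : x ∈ Set.Ico ((j : ℝ) / 2 ^ n) ((j + 1 : ℝ) / 2 ^ n)) : ⌊2 ^ n * x⌋ = j := by
  rw [Int.floor_eq_iff]
  have h1 := (div_le_iff₀ (by positivity)).1 hx.1
  have h2 := (lt_div_iff₀ (by positivity)).1 hx.2
  constructor <;> linarith

theorem lintegral_ofReal_Ico_dyadic_le {n : ℕ} {j : ℤ} {g : ℝ → ℝ} {G : ℝ → ℝ} {c : ℝ}
    (hg : IntervalIntegrable g volume ((j : ℝ) / 2 ^ n) ((j : ℝ) / 2 ^ n + 1 / 2 ^ n))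
    (hg0 : ∀ x, 0 ≤ g x)
    (hc : ∫ x in ((j : ℝ) / 2 ^ n)..((j : ℝ) / 2 ^ n + 1 / 2 ^ n), g x ≤ c)
    (hG : ∀ x ∈ Set.Ico ((j : ℝ) / 2 ^ n) ((j + 1 : ℝ) / 2 ^ n), G x = g x) :
    ∫⁻ x in Set.Ico ((j : ℝ) / 2 ^ n) ((j + 1 : ℝ) / 2 ^ n), ENNReal.ofReal (G x)
      ≤ ENNReal.ofReal c := by
  have hle : (j : ℝ) / 2 ^ n ≤ (j : ℝ) / 2 ^ n + 1 / 2 ^ n := by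
    have : (0 : ℝ) < 1 / 2 ^ n := by positivity
    linarith
  rw [setLIntegral_congr_fun measurableSet_Ico fun x hx => by rw [hG x hx],
    setLIntegral_congr Ico_ae_eq_Ioc, add_div,
    ← ofReal_integral_eq_lintegral_ofReal ((intervalIntegrable_iff_integrableOn_Ioc_of_le hle).1 hg)
      (Filter.Eventually.of_forall hg0), ← intervalIntegral.integral_of_le hle]
  exact ENNReal.ofReal_le_ofReal hc

/-- An interval of length at most `2⁻ⁿ` meets at most two dyadic intervals of length `2⁻ⁿ`. -/
theorem setLIntegral_comp_add_le_of_dyadic {n : ℕ} {a ℓ t : ℝ} (hℓ : ℓ ≤ 1 / 2 ^ n)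
    {g : ℝ → ENNReal} {c : ENNReal}
    (hc : ∀ j : ℤ, ∫⁻ x in Set.Ico ((j : ℝ) / 2 ^ n) ((j + 1 : ℝ) / 2 ^ n), g x ≤ c) :
    ∫⁻ x in Set.Ioc a (a + ℓ), g (x + t) ≤ 2 * c := by
  set j : ℤ := ⌊2 ^ n * (a + t)⌋ with hj
  have h1 : ((j : ℝ)) / 2 ^ n ≤ a + t := by
    rw [div_le_iff₀ (by positivity), mul_comm]
    exact Int.floor_le _
  have h2 : a + t < (j + 1 : ℝ) / 2 ^ n := by
    rw [lt_div_iff₀ (by positivity), mul_comm]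
    exact Int.lt_floor_add_one _
  have hpre : Set.Ioc a (a + ℓ) = (fun x => x + t) ⁻¹' Set.Ioc (a + t) (a + ℓ + t) := by
    rw [Set.preimage_add_const_Ioc]; simp
  have hsub : Set.Ioc (a + t) (a + ℓ + t) ⊆
      Set.Ico ((j : ℝ) / 2 ^ n) ((j + 1 : ℝ) / 2 ^ n) ∪
        Set.Ico (((j + 1 : ℤ) : ℝ) / 2 ^ n) (((j + 1 : ℤ) + 1 : ℝ) / 2 ^ n) := by
    intro x hx
    push_cast
    have h3 : (j + 1 + 1 : ℝ) / 2 ^ n = (j + 1 : ℝ) / 2 ^ n + 1 / 2 ^ n := by ring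
    by_cases hxj : x < (j + 1 : ℝ) / 2 ^ n
    · exact Or.inl ⟨by linarith [hx.1], hxj⟩
    · exact Or.inr ⟨not_lt.1 hxj, by rw [h3]; linarith [hx.2]⟩
  have hmp : MeasurePreserving (fun x : ℝ => x + t) volume volume :=
    measurePreserving_add_right volume t
  rw [hpre, hmp.setLIntegral_comp_preimage_emb (measurableEmbedding_addRight t)]
  calc _ ≤ _ := lintegral_mono_set hsub
    _ ≤ _ := lintegral_union_le _ _ _
    _ ≤ c + c := add_le_add (hc _) (hc _)
    _ = 2 * c := (two_mul c).symm

/-- The number of dyadic points of scales `2⁻¹, …, 2⁻ⁿ` crossed, up to an additive constant. -/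
noncomputable def dyadicCount (n : ℕ) (x : ℝ) : ℝ :=
  ∑ k ∈ Finset.range n, (⌊2 ^ (k + 1) * x⌋ : ℝ)

/-- If consecutive dyadic averages of `f` differ by at most `L`, then `dyadicAvg n f` varies at
most as much as the count of dyadic points. -/
theorem abs_dyadicAvg_sub_le {f : ℝ → ℝ} {L : ℝ} (hf : Function.Periodic f 1)
    (hL : ∀ n x, |dyadicAvg (n + 1) f x - dyadicAvg n f x| ≤ L) (n : ℕ) {x y : ℝ} (hxy : x ≤ y) :
    |dyadicAvg n f y - dyadicAvg n f x| ≤ 2 * L * (dyadicCount n y - dyadicCount n x) := by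
  have hL0 : 0 ≤ L := (abs_nonneg _).trans (hL 0 0)
  induction n with
  | zero =>
    have h (z : ℝ) : dyadicAvg 0 f z = avgT f 0 1 := by
      have := avgT_add_intCast hf 0 1 ⌊z⌋
      simpa [dyadicAvg] using this
    simp [h, dyadicCount]
  | succ n ih =>
    have hfl : ⌊(2 : ℝ) ^ (n + 1) * x⌋ ≤ ⌊(2 : ℝ) ^ (n + 1) * y⌋ := by gcongr
    have hcount : dyadicCount (n + 1) y - dyadicCount (n + 1) x
        = (dyadicCount n y - dyadicCount n x)
          + ((⌊(2 : ℝ) ^ (n + 1) * y⌋ : ℝ) - ⌊(2 : ℝ) ^ (n + 1) * x⌋) := by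
      simp only [dyadicCount, Finset.sum_range_succ]
      ring
    rcases hfl.eq_or_lt with heq | hlt
    · have h1 : dyadicAvg (n + 1) f y = dyadicAvg (n + 1) f x := by simp [dyadicAvg, heq]
      rw [hcount, h1, heq, sub_self, abs_zero, sub_self, add_zero]
      exact (abs_nonneg _).trans ih
    · have h1 : (1 : ℝ) ≤ (⌊(2 : ℝ) ^ (n + 1) * y⌋ : ℝ) - ⌊(2 : ℝ) ^ (n + 1) * x⌋ := by
        have h2 : ⌊(2 : ℝ) ^ (n + 1) * x⌋ + 1 ≤ ⌊(2 : ℝ) ^ (n + 1) * y⌋ := hlt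
        have h3 : ((⌊(2 : ℝ) ^ (n + 1) * x⌋ + 1 : ℤ) : ℝ) ≤ ⌊(2 : ℝ) ^ (n + 1) * y⌋ := by
          exact_mod_cast h2
        push_cast at h3
        linarith
      have h2 := abs_le.1 (hL n x)
      have h3 := abs_le.1 (hL n y)
      have h4 := abs_le.1 ih
      have h5 : 2 * L ≤ 2 * L * ((⌊(2 : ℝ) ^ (n + 1) * y⌋ : ℝ) - ⌊(2 : ℝ) ^ (n + 1) * x⌋) :=
        le_mul_of_one_le_right (by positivity) h1
      rw [hcount, mul_add, abs_le]
      constructor <;> linarith [h2.1, h2.2, h3.1, h3.2, h4.1, h4.2]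

/-- **Jensen's inequality** for the exponential, without integrability of the exponential. -/
theorem ofReal_exp_integral_le_lintegral {T : Type*} [MeasurableSpace T] {ν : Measure T}
    [IsProbabilityMeasure ν] {D : T → ℝ} (hD : Integrable D ν) :
    ENNReal.ofReal (Real.exp (∫ t, D t ∂ν)) ≤ ∫⁻ t, ENNReal.ofReal (Real.exp (D t)) ∂ν := by
  have hm : AEStronglyMeasurable (fun t => Real.exp (D t)) ν :=
    Real.continuous_exp.comp_aestronglyMeasurable hD.aestronglyMeasurable
  by_cases htop : ∫⁻ t, ENNReal.ofReal (Real.exp (D t)) ∂ν = ⊤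
  · simp [htop]
  have hi : Integrable (fun t => Real.exp (D t)) ν :=
    (lintegral_ofReal_ne_top_iff_integrable hm
      (Filter.Eventually.of_forall fun t => (Real.exp_pos _).le)).1 htop
  rw [← ofReal_integral_eq_lintegral_ofReal hi
    (Filter.Eventually.of_forall fun t => (Real.exp_pos _).le)]
  exact ENNReal.ofReal_le_ofReal (convexOn_exp.map_integral_le Real.continuous_exp.continuousOn
    isClosed_univ (Filter.Eventually.of_forall fun t => Set.mem_univ _) hD hi)

/-- Averaging a family `F = H + D`, where `D` has uniformly bounded exponential and absolute
integrals and the average of `H` oscillates by at most `K`, gives a function whose exponential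
integral and mean are controlled by the same constant `g`. -/
theorem exists_integral_exp_le_and_le_integral {T X : Type*} [MeasurableSpace T]
    [MeasurableSpace X] {ν : Measure T} [IsProbabilityMeasure ν] {μ : Measure X}
    [IsFiniteMeasure μ] [NeZero μ] {F H : T → X → ℝ} {s : Set X} {M N K : ℝ}
    (hF : Integrable (fun q : T × X => F q.1 q.2) (ν.prod μ))
    (hH : AEStronglyMeasurable (fun q : T × X => H q.1 q.2) (ν.prod μ))
    (hM0 : 0 ≤ M) (hN0 : 0 ≤ N)
    (hM : ∀ᵐ t ∂ν, ∫⁻ x, ENNReal.ofReal (Real.exp (F t x - H t x)) ∂μ ≤ ENNReal.ofReal M)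
    (hN : ∀ᵐ t ∂ν, ∫⁻ x, ENNReal.ofReal |F t x - H t x| ∂μ ≤ ENNReal.ofReal N)
    (hs : ∀ᵐ x ∂μ, x ∈ s)
    (hK : ∀ x ∈ s, ∀ y ∈ s, Integrable (fun t => H t x) ν → Integrable (fun t => H t y) ν →
      |∫ t, H t x ∂ν - ∫ t, H t y ∂ν| ≤ K) :
    ∃ g : ℝ, ∫ x, Real.exp (∫ t, F t x ∂ν) ∂μ ≤ Real.exp (g + K) * M ∧
      μ.real Set.univ * (g - K) - N ≤ ∫ x, ∫ t, F t x ∂ν ∂μ := by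
  have hDm : AEStronglyMeasurable (fun q : T × X => F q.1 q.2 - H q.1 q.2) (ν.prod μ) :=
    hF.aestronglyMeasurable.sub hH
  have hDlint : ∫⁻ q, ENNReal.ofReal ‖F q.1 q.2 - H q.1 q.2‖ ∂(ν.prod μ) ≤ ENNReal.ofReal N := by
    rw [lintegral_prod _ hDm.norm.aemeasurable.ennreal_ofReal]
    calc _ ≤ ∫⁻ _, ENNReal.ofReal N ∂ν := lintegral_mono_ae (by simpa using hN)
      _ = ENNReal.ofReal N := by simp
  have hD : Integrable (fun q : T × X => F q.1 q.2 - H q.1 q.2) (ν.prod μ) := by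
    refine ⟨hDm, ?_⟩
    rw [hasFiniteIntegral_iff_norm]
    exact hDlint.trans_lt ENNReal.ofReal_lt_top
  have hHi : Integrable (fun q : T × X => H q.1 q.2) (ν.prod μ) := by
    refine (hF.sub hD).congr (Filter.Eventually.of_forall fun q => ?_)
    simp
  have hFx := hF.prod_left_ae
  have hHx := hHi.prod_left_ae
  obtain ⟨x₀, hx₀s, hx₀⟩ := (hs.and hHx).exists
  refine ⟨∫ t, H t x₀ ∂ν, ?_, ?_⟩
  · have hpt : ∀ᵐ x ∂μ, ENNReal.ofReal (Real.exp (∫ t, F t x ∂ν)) ≤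
        ENNReal.ofReal (Real.exp (∫ t, H t x₀ ∂ν + K)) *
          ∫⁻ t, ENNReal.ofReal (Real.exp (F t x - H t x)) ∂ν := by
      filter_upwards [hFx, hHx, hs] with x h1 h2 h3
      have h4 := (abs_le.1 (hK x h3 x₀ hx₀s h2 hx₀)).2
      calc ENNReal.ofReal (Real.exp (∫ t, F t x ∂ν))
          ≤ ENNReal.ofReal (Real.exp (∫ t, H t x₀ ∂ν + K) *
              Real.exp (∫ t, (F t x - H t x) ∂ν)) := by
            rw [← Real.exp_add, integral_sub h1 h2]
            apply ENNReal.ofReal_le_ofReal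
            apply Real.exp_le_exp.2
            linarith
        _ = _ := ENNReal.ofReal_mul (Real.exp_pos _).le
        _ ≤ _ := by gcongr; exact ofReal_exp_integral_le_lintegral (h1.sub h2)
    have hexpm : AEMeasurable (fun q : T × X => ENNReal.ofReal (Real.exp (F q.1 q.2 - H q.1 q.2)))
        (ν.prod μ) := hDm.aemeasurable.exp.ennreal_ofReal
    have hle : ∫⁻ x, ENNReal.ofReal (Real.exp (∫ t, F t x ∂ν)) ∂μ ≤
        ENNReal.ofReal (Real.exp (∫ t, H t x₀ ∂ν + K) * M) :=
      calc _ ≤ ∫⁻ x, ENNReal.ofReal (Real.exp (∫ t, H t x₀ ∂ν + K)) *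
          ∫⁻ t, ENNReal.ofReal (Real.exp (F t x - H t x)) ∂ν ∂μ := lintegral_mono_ae hpt
        _ = ENNReal.ofReal (Real.exp (∫ t, H t x₀ ∂ν + K)) *
          ∫⁻ x, ∫⁻ t, ENNReal.ofReal (Real.exp (F t x - H t x)) ∂ν ∂μ :=
            lintegral_const_mul' _ _ ENNReal.ofReal_ne_top
        _ = ENNReal.ofReal (Real.exp (∫ t, H t x₀ ∂ν + K)) *
          ∫⁻ t, ∫⁻ x, ENNReal.ofReal (Real.exp (F t x - H t x)) ∂μ ∂ν := by
            rw [← lintegral_prod_symm _ hexpm, lintegral_prod _ hexpm]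
        _ ≤ ENNReal.ofReal (Real.exp (∫ t, H t x₀ ∂ν + K)) * ∫⁻ _, ENNReal.ofReal M ∂ν := by
            exact mul_le_mul_right (lintegral_mono_ae hM) _
        _ = _ := by simp [ENNReal.ofReal_mul (Real.exp_pos _).le]
    by_cases hi : Integrable (fun x => Real.exp (∫ t, F t x ∂ν)) μ
    · rw [← ofReal_integral_eq_lintegral_ofReal hi
        (Filter.Eventually.of_forall fun t => (Real.exp_pos _).le)] at hle
      exact (ENNReal.ofReal_le_ofReal_iff (by positivity)).1 hle
    · rw [integral_undef hi]
      positivity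
  · have h1 : ∫ x, ∫ t, F t x ∂ν ∂μ = ∫ x, ∫ t, H t x ∂ν ∂μ +
        ∫ q, (F q.1 q.2 - H q.1 q.2) ∂(ν.prod μ) := by
      rw [integral_sub hF hHi, integral_prod_symm _ hF, integral_prod_symm _ hHi]
      ring
    have h2 : μ.real Set.univ * (∫ t, H t x₀ ∂ν - K) ≤ ∫ x, ∫ t, H t x ∂ν ∂μ := by
      rw [← smul_eq_mul, ← integral_const]
      refine integral_mono_ae (integrable_const _) hHi.integral_prod_right ?_
      filter_upwards [hHx, hs] with x h2 h3
      have h4 := (abs_le.1 (hK x h3 x₀ hx₀s h2 hx₀)).1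
      linarith
    have h3 := (abs_le.1 ((norm_integral_le_lintegral_norm _).trans
      (ENNReal.toReal_le_of_le_ofReal hN0 hDlint))).1
    linarith

section DyadicWeight

variable {w : ℝ → ℝ} {V : ℝ}

theorem intervalIntegrable_exp_log_sub (hw : ∀ x, 0 < w x) (hloc : LocallyIntegrable w)
    (m a b : ℝ) : IntervalIntegrable (fun x => Real.exp (Real.log (w x) - m)) volume a b := by
  have h1 : (fun x => Real.exp (Real.log (w x) - m)) = fun x => w x * Real.exp (-m) := by
    funext x
    rw [sub_eq_add_neg, Real.exp_add, Real.exp_log (hw x)]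
  rw [h1]
  exact (hloc.integrableOn_isCompact isCompact_uIcc).intervalIntegrable.mul_const _

theorem lintegral_exp_sub_dyadicAvg_le (hw : ∀ x, 0 < w x) (hper : Function.Periodic w 1)
    (hloc : LocallyIntegrable w) (hV : ∀ a ℓ : ℝ, IsDyadicT a ℓ → AinfQ w a ℓ ≤ V)
    (n : ℕ) (j : ℤ) :
    ∫⁻ x in Set.Ico ((j : ℝ) / 2 ^ n) ((j + 1 : ℝ) / 2 ^ n), ENNReal.ofReal
      (Real.exp (Real.log (w x) - dyadicAvg n (fun y => Real.log (w y)) x))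
      ≤ ENNReal.ofReal (V * (1 / 2 ^ n)) := by
  refine lintegral_ofReal_Ico_dyadic_le (intervalIntegrable_exp_log_sub hw hloc
    (avgT (fun y => Real.log (w y)) ((j : ℝ) / 2 ^ n) (1 / 2 ^ n)) _ _)
    (fun x => (Real.exp_pos _).le) (integral_exp_sub_avgT_le hw (by positivity)
      (AinfQ_dyadic_le hper hV n j)) fun x hx => ?_
  simp only [dyadicAvg, floor_two_pow_mul_eq hx]

theorem integral_abs_sub_dyadic_avgT_le (hw : ∀ x, 0 < w x) (hper : Function.Periodic w 1)
    (hloc : LocallyIntegrable w) (hV : ∀ a ℓ : ℝ, IsDyadicT a ℓ → AinfQ w a ℓ ≤ V)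
    (hlog : ∀ a b, IntervalIntegrable (fun x => Real.log (w x)) volume a b) (n : ℕ) (j : ℤ) :
    ∫ x in ((j : ℝ) / 2 ^ n)..((j : ℝ) / 2 ^ n + 1 / 2 ^ n),
      |Real.log (w x) - avgT (fun y => Real.log (w y)) ((j : ℝ) / 2 ^ n) (1 / 2 ^ n)|
      ≤ 2 * V * (1 / 2 ^ n) :=
  integral_abs_sub_avgT_le (f := fun y => Real.log (w y)) (by positivity) (hlog _ _)
    (intervalIntegrable_exp_log_sub hw hloc _ _ _)
    (integral_exp_sub_avgT_le hw (by positivity) (AinfQ_dyadic_le hper hV n j))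

theorem lintegral_abs_sub_dyadicAvg_le (hw : ∀ x, 0 < w x) (hper : Function.Periodic w 1)
    (hloc : LocallyIntegrable w) (hV : ∀ a ℓ : ℝ, IsDyadicT a ℓ → AinfQ w a ℓ ≤ V)
    (hlog : ∀ a b, IntervalIntegrable (fun x => Real.log (w x)) volume a b) (n : ℕ) (j : ℤ) :
    ∫⁻ x in Set.Ico ((j : ℝ) / 2 ^ n) ((j + 1 : ℝ) / 2 ^ n), ENNReal.ofReal
      |Real.log (w x) - dyadicAvg n (fun y => Real.log (w y)) x|
      ≤ ENNReal.ofReal (2 * V * (1 / 2 ^ n)) := by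
  refine lintegral_ofReal_Ico_dyadic_le ((hlog _ _).sub intervalIntegrable_const).abs
    (fun x => abs_nonneg _) (integral_abs_sub_dyadic_avgT_le hw hper hloc hV hlog n j)
    fun x hx => ?_
  simp only [dyadicAvg, floor_two_pow_mul_eq hx]

theorem abs_dyadicAvg_succ_sub_le (hw : ∀ x, 0 < w x) (hper : Function.Periodic w 1)
    (hloc : LocallyIntegrable w) (hV : ∀ a ℓ : ℝ, IsDyadicT a ℓ → AinfQ w a ℓ ≤ V)
    (hlog : ∀ a b, IntervalIntegrable (fun x => Real.log (w x)) volume a b) (n : ℕ) (x : ℝ) :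
    |dyadicAvg (n + 1) (fun y => Real.log (w y)) x - dyadicAvg n (fun y => Real.log (w y)) x|
      ≤ 4 * V := by
  have h1 : (2 : ℝ) ^ n * x = (2 : ℝ) ^ (n + 1) * x / (2 : ℕ) := by
    push_cast; ring
  have h2 : ⌊(2 : ℝ) ^ n * x⌋ = ⌊(2 : ℝ) ^ (n + 1) * x⌋ / 2 := by
    rw [h1, Int.floor_div_natCast]; rfl
  unfold dyadicAvg
  set i := ⌊(2 : ℝ) ^ (n + 1) * x⌋
  set j := ⌊(2 : ℝ) ^ n * x⌋
  have h3 : ((2 * j : ℤ) : ℝ) ≤ i := by exact_mod_cast (by omega : 2 * j ≤ i)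
  have h4 : (i : ℝ) ≤ ((2 * j + 1 : ℤ) : ℝ) := by exact_mod_cast (by omega : i ≤ 2 * j + 1)
  push_cast at h3 h4
  have h5 : (j : ℝ) / 2 ^ n = 2 * j / 2 ^ (n + 1) := by rw [pow_succ]; field_simp
  have h6 : (1 : ℝ) / 2 ^ n = 2 / 2 ^ (n + 1) := by rw [pow_succ]; field_simp
  have h7 := abs_avgT_sub_avgT_le (f := fun y => Real.log (w y)) (V := 2 * V)
    (a := (j : ℝ) / 2 ^ n) (ℓ := 1 / 2 ^ n) (b := (i : ℝ) / 2 ^ (n + 1)) (h := 1 / 2 ^ (n + 1))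
    (by positivity) (by rw [h6]; ring) (by rw [h5]; gcongr)
    (by rw [h5, h6, ← add_div, ← add_div]; gcongr ?_ / _; linarith) (hlog _ _)
    (integral_abs_sub_dyadic_avgT_le hw hper hloc hV hlog n j)
  linarith

end DyadicWeight

theorem intervalIntegrable_floor_mul_add (c x a b : ℝ) (hc : 0 ≤ c) :
    IntervalIntegrable (fun t => (⌊c * (x + t)⌋ : ℝ)) volume a b := by
  refine Monotone.intervalIntegrable fun s t hst => ?_
  have : ⌊c * (x + s)⌋ ≤ ⌊c * (x + t)⌋ := by gcongr
  exact_mod_cast this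

theorem integral_floor_mul_add_sub (m : ℕ) (x y : ℝ) :
    ∫ t in (0 : ℝ)..1, ((⌊(m : ℝ) * (y + t)⌋ : ℝ) - ⌊(m : ℝ) * (x + t)⌋) = m * (y - x) := by
  have hm : (0 : ℝ) ≤ m := m.cast_nonneg
  have hper : Function.Periodic (fun t => Int.fract ((m : ℝ) * t)) 1 := fun t => by
    simp only [mul_add, mul_one, Int.fract_add_natCast]
  have hfr (z : ℝ) : ∫ t in (0 : ℝ)..1, Int.fract ((m : ℝ) * (z + t))
      = ∫ t in (0 : ℝ)..1, Int.fract ((m : ℝ) * t) := by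
    rw [intervalIntegral.integral_comp_add_left (fun t => Int.fract ((m : ℝ) * t)), add_zero]
    simpa using hper.intervalIntegral_add_eq z 0
  have hi (z : ℝ) : IntervalIntegrable (fun t => (m : ℝ) * (z + t)) volume 0 1 :=
    (by fun_prop : Continuous fun t => (m : ℝ) * (z + t)).intervalIntegrable _ _
  have hfl (z : ℝ) : ∫ t in (0 : ℝ)..1, (⌊(m : ℝ) * (z + t)⌋ : ℝ)
      = (∫ t in (0 : ℝ)..1, (m : ℝ) * (z + t)) - ∫ t in (0 : ℝ)..1, Int.fract ((m : ℝ) * t) := by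
    rw [← hfr z, ← intervalIntegral.integral_sub (hi z)]
    · simp [Int.self_sub_fract]
    · exact (hi z).sub (intervalIntegrable_floor_mul_add m z 0 1 hm)
  rw [intervalIntegral.integral_sub (intervalIntegrable_floor_mul_add m y 0 1 hm)
    (intervalIntegrable_floor_mul_add m x 0 1 hm), hfl, hfl, sub_sub_sub_cancel_right,
    ← intervalIntegral.integral_sub (hi y) (hi x)]
  simp [← mul_sub]

theorem intervalIntegrable_dyadicCount_add (n : ℕ) (x a b : ℝ) :
    IntervalIntegrable (fun t => dyadicCount n (x + t)) volume a b := by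
  have h := IntervalIntegrable.sum (Finset.range n) fun k _ =>
    intervalIntegrable_floor_mul_add (2 ^ (k + 1)) x a b (by positivity)
  exact h.congr fun t _ => by simp [dyadicCount]

theorem integral_dyadicCount_sub_le (n : ℕ) {x y : ℝ} (hxy : x ≤ y) :
    ∫ t in (0 : ℝ)..1, (dyadicCount n (y + t) - dyadicCount n (x + t))
      ≤ 2 ^ (n + 1) * (y - x) := by
  have h1 (k : ℕ) : ∫ t in (0 : ℝ)..1,
      ((⌊(2 : ℝ) ^ (k + 1) * (y + t)⌋ : ℝ) - ⌊(2 : ℝ) ^ (k + 1) * (x + t)⌋)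
      = 2 ^ (k + 1) * (y - x) := by
    simpa using integral_floor_mul_add_sub (2 ^ (k + 1)) x y
  simp only [dyadicCount, ← Finset.sum_sub_distrib]
  rw [intervalIntegral.integral_finsetSum fun k _ =>
    (intervalIntegrable_floor_mul_add _ y 0 1 (by positivity)).sub
      (intervalIntegrable_floor_mul_add _ x 0 1 (by positivity))]
  simp only [h1, ← Finset.sum_mul]
  refine mul_le_mul_of_nonneg_right ?_ (sub_nonneg.2 hxy)
  · simp only [pow_succ, ← Finset.sum_mul]
    gcongr
    rw [geom_sum_eq (by norm_num)]
    norm_num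

theorem measurable_dyadicAvg_add {f : ℝ → ℝ → ℝ} (hf : Measurable fun q : ℝ × ℝ => f q.1 q.2)
    (n : ℕ) : Measurable fun q : ℝ × ℝ => dyadicAvg n (f q.1) (q.2 + q.1) := by
  have h0 : (0 : ℝ) ≤ 1 / 2 ^ n := by positivity
  have h1 (t x : ℝ) : dyadicAvg n (f t) x = 1 / (1 / 2 ^ n) *
      ∫ s in Set.Ioc (0 : ℝ) (1 / 2 ^ n), f t ((⌊(2 : ℝ) ^ n * x⌋ : ℝ) / 2 ^ n + s) := by
    rw [dyadicAvg, avgT, ← intervalIntegral.integral_of_le h0,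
      intervalIntegral.integral_comp_add_left (f t), add_zero]
  simp only [h1]
  refine Measurable.const_mul (StronglyMeasurable.measurable ?_) _
  refine StronglyMeasurable.integral_prod_right (f := fun (q : ℝ × ℝ) (s : ℝ) =>
    f q.1 ((⌊(2 : ℝ) ^ n * (q.2 + q.1)⌋ : ℝ) / 2 ^ n + s)) ?_
  refine (hf.comp (f := fun z : (ℝ × ℝ) × ℝ =>
    (z.1.1, (⌊(2 : ℝ) ^ n * (z.1.2 + z.1.1)⌋ : ℝ) / 2 ^ n + z.2)) ?_).stronglyMeasurable
  fun_prop

theorem integrable_translate_of_periodic {f : ℝ → ℝ → ℝ}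
    (hf : Measurable fun q : ℝ × ℝ => f q.1 q.2) (hper : ∀ t, Function.Periodic (f t) 1)
    (hint : Integrable (fun q : ℝ × ℝ => f q.1 q.2)
      ((volume.restrict (Set.Ioc 0 1)).prod (volume.restrict (Set.Ioc 0 1))))
    {a ℓ : ℝ} (hℓ : ℓ ≤ 1) :
    Integrable (fun q : ℝ × ℝ => f q.1 (q.2 + q.1))
      ((volume.restrict (Set.Ioc 0 1)).prod (volume.restrict (Set.Ioc a (a + ℓ)))) := by
  have hm : Measurable fun q : ℝ × ℝ => f q.1 (q.2 + q.1) :=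
    hf.comp (f := fun q : ℝ × ℝ => (q.1, q.2 + q.1)) (by fun_prop)
  have hbig : Integrable (fun q : ℝ × ℝ => f q.1 (q.2 + q.1))
      ((volume.restrict (Set.Ioc 0 1)).prod (volume.restrict (Set.Ioc a (a + 1)))) := by
    obtain ⟨h1, h2⟩ := (integrable_prod_iff hint.aestronglyMeasurable).1 hint
    refine (integrable_prod_iff hm.aestronglyMeasurable).2 ⟨?_, ?_⟩
    · filter_upwards [h1] with t ht
      have h3 : IntervalIntegrable (f t) volume (a + t) (a + 1 + t) :=
        (hper t).intervalIntegrable₀ one_ne_zero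
          ((intervalIntegrable_iff_integrableOn_Ioc_of_le zero_le_one).2 ht) _ _
      have h4 := h3.comp_add_right t
      simp only [add_sub_cancel_right] at h4
      exact (intervalIntegrable_iff_integrableOn_Ioc_of_le (by linarith)).1 h4
    · refine h2.congr (Filter.Eventually.of_forall fun t => ?_)
      have hp : Function.Periodic (fun x => ‖f t x‖) 1 := fun x => by simp only [hper t x]
      have h3 := hp.intervalIntegral_add_eq 0 (a + t)
      simp only
      rw [← intervalIntegral.integral_of_le zero_le_one,
        ← intervalIntegral.integral_of_le (by linarith),
        intervalIntegral.integral_comp_add_right (fun x => ‖f t x‖)]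
      rw [zero_add] at h3
      rw [h3]
      congr 1
      ring
  refine hbig.mono_measure (Measure.prod_mono le_rfl (Measure.restrict_mono ?_ le_rfl))
  exact Set.Ioc_subset_Ioc_right (by linarith)

/-- **Geometric-arithmetic averaging for `A_∞`.** -/
theorem geometric_arithmetic_average_Ainf (V : ℝ) :
    ∃ C : ℝ, ∀ ω : ℝ → ℝ → ℝ,
      (∀ t x, 0 < ω t x) →
      (∀ t, Function.Periodic (ω t) 1) →
      (∀ t ∈ Set.Icc (0:ℝ) 1, LocallyIntegrable (ω t)) →
      -- (i) joint measurability
      Measurable (fun q : ℝ × ℝ => ω q.1 q.2) →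
      -- (ii) normalization of the logarithms
      IntegrableOn (fun q : ℝ × ℝ => Real.log (ω q.1 q.2))
        (Set.Icc (0:ℝ) 1 ×ˢ Set.Icc (0:ℝ) 1) →
      -- (iii) uniform bound on the dyadic `A_∞` constants
      (∀ t ∈ Set.Icc (0:ℝ) 1, ∀ a ℓ : ℝ, IsDyadicT a ℓ → AinfQ (ω t) a ℓ ≤ V) →
      -- conclusion: `Ω ∈ A_∞(𝕋)` with `A_∞(Ω) ≤ C`, `C` depending only on `V`
      ∀ a ℓ : ℝ, IsIntervalT a ℓ → AinfQ (gaAvg ω) a ℓ ≤ C := by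
  refine ⟨4 * V * Real.exp (40 * V), ?_⟩
  intro ω hpos hper hloc hmeas hint hV a ℓ ⟨hℓ0, hℓ1⟩
  have hV0 : 0 ≤ V := by
    refine le_trans ?_ (hV 0 (by simp) 0 1 (Or.inl ⟨rfl, rfl⟩))
    unfold AinfQ avgT
    have : 0 ≤ ∫ x in (0 : ℝ)..(0 + 1), ω 0 x :=
      intervalIntegral.integral_nonneg (by norm_num) fun x _ => (hpos 0 x).le
    positivity
  obtain ⟨n, hn1, hn2⟩ := exists_nat_pow_near_of_lt_one hℓ0 hℓ1
    (by norm_num : (0 : ℝ) < 2⁻¹) (by norm_num)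
  rw [inv_pow, ← one_div] at hn1 hn2
  have hn3 : (1 : ℝ) / 2 ^ n ≤ 2 * ℓ := by
    rw [pow_succ] at hn1
    have : (1 : ℝ) / (2 ^ n * 2) = (1 / 2 ^ n) / 2 := by field_simp
    linarith
  set ν : Measure ℝ := volume.restrict (Set.Ioc 0 1) with hν
  set μ : Measure ℝ := volume.restrict (Set.Ioc a (a + ℓ)) with hμ
  have : IsProbabilityMeasure ν := ⟨by simp [hν]⟩
  have : NeZero μ := ⟨by simp [hμ, Measure.restrict_eq_zero, hℓ0]⟩
  have hμu : μ.real Set.univ = ℓ := by simp [hμ, measureReal_def, hℓ0.le]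
  set φ : ℝ → ℝ → ℝ := fun t x => Real.log (ω t x) with hφ
  have hφm : Measurable fun q : ℝ × ℝ => φ q.1 q.2 := hmeas.log
  have hφper : ∀ t, Function.Periodic (φ t) 1 := fun t x => by simp only [hφ, hper t x]
  have hφint : Integrable (fun q : ℝ × ℝ => φ q.1 q.2) (ν.prod ν) := by
    rw [hν, Measure.prod_restrict]
    exact hint.mono_set (Set.prod_mono Set.Ioc_subset_Icc_self Set.Ioc_subset_Icc_self)
  have hgood : ∀ᵐ t ∂ν, t ∈ Set.Icc (0 : ℝ) 1 ∧ ∀ b c, IntervalIntegrable (φ t) volume b c := by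
    have hmem : ∀ᵐ t ∂ν, t ∈ Set.Ioc (0 : ℝ) 1 := ae_restrict_mem measurableSet_Ioc
    filter_upwards [hmem, hφint.prod_right_ae] with t h1 h2
    exact ⟨Set.Ioc_subset_Icc_self h1, (hφper t).intervalIntegrable₀ one_ne_zero
      ((intervalIntegrable_iff_integrableOn_Ioc_of_le zero_le_one).2 h2)⟩
  have hle (c : ℝ) (hc : 0 ≤ c) (g : ℝ → ENNReal) (t : ℝ)
      (h : ∀ j : ℤ, ∫⁻ x in Set.Ico ((j : ℝ) / 2 ^ n) ((j + 1 : ℝ) / 2 ^ n), g x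
        ≤ ENNReal.ofReal (c * (1 / 2 ^ n))) :
      ∫⁻ x, g (x + t) ∂μ ≤ ENNReal.ofReal (4 * c * ℓ) := by
    refine (setLIntegral_comp_add_le_of_dyadic hn2 h).trans ?_
    rw [← ENNReal.ofReal_ofNat, ← ENNReal.ofReal_mul (by norm_num)]
    apply ENNReal.ofReal_le_ofReal
    nlinarith
  obtain ⟨g, hg1, hg2⟩ := exists_integral_exp_le_and_le_integral (ν := ν) (μ := μ)
    (F := fun t x => φ t (x + t)) (H := fun t x => dyadicAvg n (φ t) (x + t))
    (s := Set.Ioc a (a + ℓ)) (M := 4 * V * ℓ) (N := 4 * (2 * V) * ℓ) (K := 16 * V)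
    (integrable_translate_of_periodic hφm hφper hφint hℓ1)
    (measurable_dyadicAvg_add hφm n).aestronglyMeasurable (by positivity) (by positivity)
    (by
      filter_upwards [hgood] with t ⟨ht, _⟩
      exact hle V hV0 (fun x => ENNReal.ofReal (Real.exp (φ t x - dyadicAvg n (φ t) x))) t
        (lintegral_exp_sub_dyadicAvg_le (hpos t) (hper t) (hloc t ht) (hV t ht) n))
    (by
      filter_upwards [hgood] with t ⟨ht, hti⟩
      exact hle (2 * V) (by positivity)
        (fun x => ENNReal.ofReal |φ t x - dyadicAvg n (φ t) x|) t
        (lintegral_abs_sub_dyadicAvg_le (hpos t) (hper t) (hloc t ht) (hV t ht) hti n))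
    (ae_restrict_mem measurableSet_Ioc)
    (by
      have key : ∀ x ∈ Set.Ioc a (a + ℓ), ∀ y ∈ Set.Ioc a (a + ℓ), x ≤ y →
          Integrable (fun t => dyadicAvg n (φ t) (x + t)) ν →
          Integrable (fun t => dyadicAvg n (φ t) (y + t)) ν →
          |∫ t, dyadicAvg n (φ t) (y + t) ∂ν - ∫ t, dyadicAvg n (φ t) (x + t) ∂ν| ≤ 16 * V := by
        intro x hx y hy hxy hxi hyi
        have hcount : Integrable (fun t => dyadicCount n (y + t) - dyadicCount n (x + t)) ν :=
          (intervalIntegrable_iff_integrableOn_Ioc_of_le zero_le_one).1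
            ((intervalIntegrable_dyadicCount_add n y 0 1).sub
              (intervalIntegrable_dyadicCount_add n x 0 1))
        calc _ = |∫ t, (dyadicAvg n (φ t) (y + t) - dyadicAvg n (φ t) (x + t)) ∂ν| := by
              rw [integral_sub hyi hxi]
          _ ≤ ∫ t, |dyadicAvg n (φ t) (y + t) - dyadicAvg n (φ t) (x + t)| ∂ν :=
              abs_integral_le_integral_abs
          _ ≤ ∫ t, 2 * (4 * V) * (dyadicCount n (y + t) - dyadicCount n (x + t)) ∂ν := by
              refine integral_mono_ae (hyi.sub hxi).abs (hcount.const_mul _) ?_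
              filter_upwards [hgood] with t ⟨ht, hti⟩
              exact abs_dyadicAvg_sub_le (hφper t)
                (abs_dyadicAvg_succ_sub_le (hpos t) (hper t) (hloc t ht) (hV t ht) hti) n
                (by linarith)
          _ = 2 * (4 * V) * ∫ t in (0 : ℝ)..1, (dyadicCount n (y + t) - dyadicCount n (x + t)) := by
              rw [integral_const_mul, intervalIntegral.integral_of_le zero_le_one]
          _ ≤ 2 * (4 * V) * (2 ^ (n + 1) * (1 / 2 ^ n)) := by
              gcongr
              refine (integral_dyadicCount_sub_le n hxy).trans ?_
              gcongr
              linarith [hx.1, hy.2]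
          _ = 16 * V := by rw [pow_succ]; field_simp; ring
      intro x hx y hy hxi hyi
      rcases le_total x y with h | h
      · rw [abs_sub_comm]; exact key x hx y hy h hxi hyi
      · exact key y hy x hx h hyi hxi)
  have h01 : ∀ x, gaAvg ω x = Real.exp (∫ t, φ t (x + t) ∂ν) := fun x => by
    rw [gaAvg, intervalIntegral.integral_of_le zero_le_one]
  have haℓ : a ≤ a + ℓ := by linarith
  have h02 : avgT (gaAvg ω) a ℓ ≤ 4 * V * Real.exp (g + 16 * V) := by
    rw [avgT, intervalIntegral.integral_of_le haℓ, one_div_mul_eq_div, div_le_iff₀ hℓ0]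
    simp only [h01]
    calc _ ≤ _ := hg1
      _ = _ := by ring
  have h03 : avgT (fun x => Real.log (1 / gaAvg ω x)) a ℓ ≤ -g + 24 * V := by
    simp only [h01, one_div, Real.log_inv, Real.log_exp]
    rw [avgT, intervalIntegral.integral_of_le haℓ, one_div_mul_eq_div, div_le_iff₀ hℓ0,
      integral_neg]
    rw [hμu] at hg2
    linarith
  calc AinfQ (gaAvg ω) a ℓ
      ≤ 4 * V * Real.exp (g + 16 * V) * Real.exp (-g + 24 * V) := by
        unfold AinfQ
        gcongr
    _ = 4 * V * Real.exp (40 * V) := by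
        rw [mul_assoc, ← Real.exp_add]
        ring_nf
end

section
/- Suppose {φ^t}_{t∈[0,1]} is a family of functions on 𝕋 such that (i) (t,x) ↦ φ^t(x) is jointly measurable, (ii) each φ^t is in dyadic BMO with ‖φ^t‖_d ≤ B for a constant B independent of t, and (iii) each φ^t has mean value zero on 𝕋. For an interval Q ⊂ 𝕋, define φ_A(x) := ∫₀¹ Σ_{J∈𝒟, |J|<|Q|} (φ^t, h_J) h_J(x+t) dt and φ_B(x) := ∫₀¹ Σ_{J∈𝒟, |J|≥|Q|} (φ^t, h_J) h_J(x+t) dt. Then there exist constants C_A and C_B, depending only on B and independent of Q, such that for every interval Q ⊂ 𝕋 and every x₀ ∈ Q: (1/|Q|)∫_Q |φ_A(x)|² dx ≤ C_A and (1/|Q|)∫_Q |φ_B(x) − φ_B(x₀)| dx ≤ C_B. -/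
open MeasureTheory Real Set

/-- The average of `f` over the dyadic interval of generation `n` with index `j` modulo `2 ^ n`. -/
noncomputable def dyadicMean (f : ℝ → ℝ) (n : ℕ) (j : ℤ) : ℝ :=
  avgT f (((j % 2 ^ n : ℤ) : ℝ) / 2 ^ n) (1 / 2 ^ n)

/-- The generation `n` part of the Haar expansion of `f`, extended periodically. -/
noncomputable def haarLayer (f : ℝ → ℝ) (n : ℕ) (y : ℝ) : ℝ :=
  ∑ j ∈ Finset.range (2 ^ n), haarCoef f ((j : ℝ) / 2 ^ n) (1 / 2 ^ n) *
    haarT ((j : ℝ) / 2 ^ n) (1 / 2 ^ n) (Int.fract y)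

/-- The average of `g (e (n + m) ·)` over the `2 ^ m` descendants in generation `n + m` of the
node `j` of generation `n` in the binary tree. -/
noncomputable def treeMean (e : ℕ → ℤ → ℝ) (g : ℝ → ℝ) : ℕ → ℕ → ℤ → ℝ
  | 0, n, j => g (e n j)
  | m + 1, n, j => (treeMean e g m (n + 1) (2 * j) + treeMean e g m (n + 1) (2 * j + 1)) / 2

section Tree

variable {e : ℕ → ℤ → ℝ}

theorem treeMean_abs_le {a : ℕ → ℤ → ℝ} {c : ℝ}
    (ha : ∀ n j, a n j = (a (n + 1) (2 * j) + a (n + 1) (2 * j + 1)) / 2)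
    (hea : ∀ n j, |e n j - c| ≤ a n j) (m n : ℕ) (j : ℤ) :
    treeMean e (fun u => |u - c|) m n j ≤ a n j := by
  induction m generalizing n j with
  | zero => exact hea n j
  | succ m ih =>
    rw [treeMean, ha]
    linarith [ih (n + 1) (2 * j), ih (n + 1) (2 * j + 1)]

theorem abs_sub_le_treeMean
    (he : ∀ n j, e n j = (e (n + 1) (2 * j) + e (n + 1) (2 * j + 1)) / 2)
    (c : ℝ) (m n : ℕ) (j : ℤ) :
    |e n j - c| ≤ treeMean e (fun u => |u - c|) m n j := by
  induction m generalizing n j with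
  | zero => exact le_rfl
  | succ m ih =>
    rw [treeMean, he]
    have h1 := ih (n + 1) (2 * j)
    have h2 := ih (n + 1) (2 * j + 1)
    rw [abs_le] at *
    constructor <;> linarith [h1.1, h1.2, h2.1, h2.2]

theorem treeMean_sq_sub
    (he : ∀ n j, e n j = (e (n + 1) (2 * j) + e (n + 1) (2 * j + 1)) / 2)
    (c d : ℝ) (m n : ℕ) (j : ℤ) :
    treeMean e (fun u => (u - c) ^ 2) m n j =
      treeMean e (fun u => (u - d) ^ 2) m n j + 2 * (d - c) * (e n j - d) + (d - c) ^ 2 := by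
  induction m generalizing n j with
  | zero => simp only [treeMean]; ring
  | succ m ih =>
    rw [treeMean, treeMean, he, ih, ih]
    ring

/-- Dyadic John–Nirenberg inequality in `L²`: a uniform bound on the mean oscillations of a
dyadic martingale gives a uniform bound on its quadratic mean oscillations. -/
theorem treeMean_sq_le {B : ℝ} (hB : 0 < B)
    (he : ∀ n j, e n j = (e (n + 1) (2 * j) + e (n + 1) (2 * j + 1)) / 2)
    (h1 : ∀ m n j, treeMean e (fun u => |u - e n j|) m n j ≤ B) (m n : ℕ) (j : ℤ) :
    treeMean e (fun u => (u - e n j) ^ 2) m n j ≤ 18 * B ^ 2 := by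
  have hjump : ∀ n j, |e (n + 1) (2 * j) - e n j| ≤ B ∧ |e (n + 1) (2 * j + 1) - e n j| ≤ B := by
    intro n j
    have h := h1 1 n j
    have h' := he n j
    simp only [treeMean] at h
    have : e (n + 1) (2 * j + 1) - e n j = -(e (n + 1) (2 * j) - e n j) := by linarith
    rw [this, abs_neg] at h ⊢
    constructor <;> linarith
  induction m using Nat.strong_induction_on generalizing n j with
  | _ m ih =>
  have key : ∀ k < m, ∀ n j c, |e n j - c| ≤ 3 * B →
      treeMean e (fun u => (u - c) ^ 2) k n j ≤
        9 * B ^ 2 + 9 * B * treeMean e (fun u => |u - c|) k n j := by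
    intro k
    induction k with
    | zero =>
      intro _ n j c hc
      simp only [treeMean]
      have : (e n j - c) ^ 2 ≤ (3 * B) ^ 2 := sq_le_sq' (abs_le.1 hc).1 (abs_le.1 hc).2
      nlinarith [abs_nonneg (e n j - c), mul_nonneg hB.le (abs_nonneg (e n j - c))]
    | succ k ihk =>
      intro hk n j c hc
      rcases le_or_gt |e n j - c| (2 * B) with h | h
      · have hL := ihk (by omega) (n + 1) (2 * j) c (by
          have := abs_add_le (e (n + 1) (2 * j) - e n j) (e n j - c)
          rw [sub_add_sub_cancel] at this
          linarith [(hjump n j).1])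
        have hR := ihk (by omega) (n + 1) (2 * j + 1) c (by
          have := abs_add_le (e (n + 1) (2 * j + 1) - e n j) (e n j - c)
          rw [sub_add_sub_cancel] at this
          linarith [(hjump n j).2])
        rw [treeMean, treeMean]
        linarith
      · have hA := ih (k + 1) hk n j
        have hs := treeMean_sq_sub he c (e n j) (k + 1) n j
        have hl := abs_sub_le_treeMean he c (k + 1) n j
        have : (e n j - c) ^ 2 ≤ (3 * B) ^ 2 := sq_le_sq' (abs_le.1 hc).1 (abs_le.1 hc).2
        nlinarith [mul_le_mul_of_nonneg_left (h.le.trans hl) hB.le]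
  cases m with
  | zero =>
    simp only [treeMean, sub_self]
    nlinarith [sq_nonneg B]
  | succ m =>
    have hL := key m (by omega) (n + 1) (2 * j) (e n j) (by linarith [(hjump n j).1])
    have hR := key m (by omega) (n + 1) (2 * j + 1) (e n j) (by linarith [(hjump n j).2])
    have h := h1 (m + 1) n j
    rw [treeMean] at h ⊢
    nlinarith

theorem lintegral_treeMean {g : ℝ → ℝ} (hg : ∀ u, 0 ≤ g u) (m n : ℕ) (j : ℤ) :
    0 ≤ treeMean e g m n j ∧
    ∫⁻ y in Ico ((j : ℝ) / 2 ^ n) ((j + 1) / 2 ^ n),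
      ENNReal.ofReal (g (e (n + m) ⌊2 ^ (n + m) * y⌋)) ≤
      ENNReal.ofReal (treeMean e g m n j / 2 ^ n) := by
  induction m generalizing n j with
  | zero =>
    refine ⟨hg _, ?_⟩
    have : ∀ y ∈ Ico ((j : ℝ) / 2 ^ n) ((j + 1) / 2 ^ n),
        ENNReal.ofReal (g (e (n + 0) ⌊2 ^ (n + 0) * y⌋)) = ENNReal.ofReal (g (e n j)) := by
      intro y hy
      have hf : ⌊2 ^ n * y⌋ = j := by
        rw [Int.floor_eq_iff]
        rw [mem_Ico, div_le_iff₀ (by positivity), lt_div_iff₀ (by positivity)] at hy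
        constructor <;> linarith [hy.1, hy.2]
      rw [add_zero, hf]
    rw [setLIntegral_congr_fun measurableSet_Ico this, setLIntegral_const, Real.volume_Ico,
      treeMean, ← ENNReal.ofReal_mul (hg _)]
    apply le_of_eq
    congr 1
    ring
  | succ m ih =>
    obtain ⟨pL, hL⟩ := ih (n + 1) (2 * j)
    obtain ⟨pR, hR⟩ := ih (n + 1) (2 * j + 1)
    refine ⟨by simp only [treeMean]; linarith, ?_⟩
    have hu : Ico ((j : ℝ) / 2 ^ n) ((j + 1) / 2 ^ n) ⊆
        Ico (((2 * j : ℤ) : ℝ) / 2 ^ (n + 1)) (((2 * j : ℤ) + 1) / 2 ^ (n + 1)) ∪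
        Ico (((2 * j + 1 : ℤ) : ℝ) / 2 ^ (n + 1)) (((2 * j + 1 : ℤ) + 1) / 2 ^ (n + 1)) := by
      intro y hy
      have e1 : ((2 * j : ℤ) : ℝ) / 2 ^ (n + 1) = j / 2 ^ n := by
        push_cast; field_simp; ring
      have e2 : (((2 * j + 1 : ℤ) : ℝ) + 1) / 2 ^ (n + 1) = (j + 1) / 2 ^ n := by
        push_cast; field_simp; ring
      rw [e1, e2]
      push_cast
      rcases lt_or_ge y ((2 * j + 1) / 2 ^ (n + 1)) with h | h
      · exact Or.inl ⟨hy.1, h⟩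
      · exact Or.inr ⟨h, hy.2⟩
    have hn : n + (m + 1) = n + 1 + m := by ring
    rw [hn]
    refine (lintegral_mono_set hu).trans ((lintegral_union_le _ _ _).trans
      ((add_le_add hL hR).trans ?_))
    rw [← ENNReal.ofReal_add (by positivity) (by positivity), treeMean]
    apply le_of_eq
    congr 1
    field_simp
    ring

end Tree

theorem avgT_eq_half {f : ℝ → ℝ} {a ℓ : ℝ} (hℓ : 0 < ℓ)
    (hf : IntervalIntegrable f volume a (a + ℓ)) :
    avgT f a ℓ = (avgT f a (ℓ / 2) + avgT f (a + ℓ / 2) (ℓ / 2)) / 2 := by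
  have hm : a + ℓ / 2 ∈ uIcc a (a + ℓ) := by
    rw [uIcc_of_le (by linarith)]
    constructor <;> linarith
  have h1 := hf.mono_set (uIcc_subset_uIcc left_mem_uIcc hm)
  have h2 := hf.mono_set (uIcc_subset_uIcc hm right_mem_uIcc)
  have hr : a + ℓ / 2 + ℓ / 2 = a + ℓ := by ring
  rw [avgT, avgT, avgT, hr, ← intervalIntegral.integral_add_adjacent_intervals h1 h2]
  field_simp

theorem haarCoef_eq {f : ℝ → ℝ} {a ℓ : ℝ} (hℓ : 0 < ℓ)
    (hf : IntervalIntegrable f volume a (a + ℓ)) :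
    haarCoef f a ℓ =
      √ℓ / 2 * (avgT f a (ℓ / 2) - avgT f (a + ℓ / 2) (ℓ / 2)) := by
  have hm : a + ℓ / 2 ∈ uIcc a (a + ℓ) := by
    rw [uIcc_of_le (by linarith)]
    constructor <;> linarith
  have h1 := hf.mono_set (uIcc_subset_uIcc left_mem_uIcc hm)
  have h2 := hf.mono_set (uIcc_subset_uIcc hm right_mem_uIcc)
  have le1 : a ≤ a + ℓ / 2 := by linarith
  have le2 : a + ℓ / 2 ≤ a + ℓ := by linarith
  have c1 : EqOn (fun x => f x * haarT a ℓ x) (fun x => f x * (1 / √ℓ))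
      (Ioo a (a + ℓ / 2)) := by
    intro x hx
    simp only [haarT, if_pos (show a ≤ x ∧ x < a + ℓ / 2 from ⟨hx.1.le, hx.2⟩)]
  have c2 : EqOn (fun x => f x * haarT a ℓ x) (fun x => f x * -(1 / √ℓ))
      (Ioo (a + ℓ / 2) (a + ℓ)) := by
    intro x hx
    simp only [haarT, if_neg (show ¬(a ≤ x ∧ x < a + ℓ / 2) from fun h => absurd h.2 hx.1.not_gt),
      if_pos (show a + ℓ / 2 ≤ x ∧ x < a + ℓ from ⟨hx.1.le, hx.2⟩)]
  have i1 : IntervalIntegrable (fun x => f x * haarT a ℓ x) volume a (a + ℓ / 2) := by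
    rw [intervalIntegrable_iff_integrableOn_Ioo_of_le le1]
    exact ((intervalIntegrable_iff_integrableOn_Ioo_of_le le1).1 (h1.mul_const _)).congr_fun
      c1.symm measurableSet_Ioo
  have i2 : IntervalIntegrable (fun x => f x * haarT a ℓ x) volume (a + ℓ / 2) (a + ℓ) := by
    rw [intervalIntegrable_iff_integrableOn_Ioo_of_le le2]
    exact ((intervalIntegrable_iff_integrableOn_Ioo_of_le le2).1 (h2.mul_const _)).congr_fun
      c2.symm measurableSet_Ioo
  have e1 : ∫ x in a..(a + ℓ / 2), f x * haarT a ℓ x =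
      (∫ x in a..(a + ℓ / 2), f x) * (1 / √ℓ) := by
    rw [← intervalIntegral.integral_mul_const, intervalIntegral.integral_of_le le1,
      intervalIntegral.integral_of_le le1, integral_Ioc_eq_integral_Ioo,
      integral_Ioc_eq_integral_Ioo, setIntegral_congr_fun measurableSet_Ioo c1]
  have e2 : ∫ x in (a + ℓ / 2)..(a + ℓ), f x * haarT a ℓ x =
      (∫ x in (a + ℓ / 2)..(a + ℓ), f x) * -(1 / √ℓ) := by
    rw [← intervalIntegral.integral_mul_const, intervalIntegral.integral_of_le le2,
      intervalIntegral.integral_of_le le2, integral_Ioc_eq_integral_Ioo,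
      integral_Ioc_eq_integral_Ioo, setIntegral_congr_fun measurableSet_Ioo c2]
  have hr : a + ℓ / 2 + ℓ / 2 = a + ℓ := by ring
  have hs : √ℓ * √ℓ = ℓ := Real.mul_self_sqrt hℓ.le
  have hs0 : √ℓ ≠ 0 := (Real.sqrt_pos.2 hℓ).ne'
  rw [haarCoef, ← intervalIntegral.integral_add_adjacent_intervals i1 i2, e1, e2, avgT, avgT, hr]
  generalize (∫ x in a..(a + ℓ / 2), f x) = u
  generalize (∫ x in (a + ℓ / 2)..(a + ℓ), f x) = v
  generalize √ℓ = s at *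
  subst hs
  field_simp
  ring

theorem haarCoef_mul_haarT_left {f : ℝ → ℝ} {a ℓ z : ℝ} (hℓ : 0 < ℓ)
    (hf : IntervalIntegrable f volume a (a + ℓ)) (h1 : a ≤ z) (h2 : z < a + ℓ / 2) :
    haarCoef f a ℓ * haarT a ℓ z = avgT f a (ℓ / 2) - avgT f a ℓ := by
  have hs0 : √ℓ ≠ 0 := (Real.sqrt_pos.2 hℓ).ne'
  rw [haarCoef_eq hℓ hf, haarT, if_pos ⟨h1, h2⟩, avgT_eq_half hℓ hf]
  field_simp
  ring

theorem haarCoef_mul_haarT_right {f : ℝ → ℝ} {a ℓ z : ℝ} (hℓ : 0 < ℓ)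
    (hf : IntervalIntegrable f volume a (a + ℓ)) (h1 : a + ℓ / 2 ≤ z) (h2 : z < a + ℓ) :
    haarCoef f a ℓ * haarT a ℓ z = avgT f (a + ℓ / 2) (ℓ / 2) - avgT f a ℓ := by
  have hs0 : √ℓ ≠ 0 := (Real.sqrt_pos.2 hℓ).ne'
  rw [haarCoef_eq hℓ hf, haarT, if_neg fun h => absurd h.2 h1.not_gt, if_pos ⟨h1, h2⟩,
    avgT_eq_half hℓ hf]
  field_simp
  ring

theorem haarT_eq_zero {a ℓ z : ℝ} (hℓ : 0 < ℓ) (h : z < a ∨ a + ℓ ≤ z) : haarT a ℓ z = 0 := by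
  rw [haarT, if_neg, if_neg]
  · rintro ⟨h1, h2⟩
    rcases h with h | h <;> linarith
  · rintro ⟨h1, h2⟩
    rcases h with h | h <;> linarith

theorem floor_pow_succ (n : ℕ) (y : ℝ) :
    ⌊2 ^ (n + 1) * y⌋ = 2 * ⌊2 ^ n * y⌋ ∨ ⌊2 ^ (n + 1) * y⌋ = 2 * ⌊2 ^ n * y⌋ + 1 := by
  have h1 : 2 * ⌊2 ^ n * y⌋ ≤ ⌊2 ^ (n + 1) * y⌋ := by
    rw [Int.le_floor]
    push_cast
    rw [pow_succ]
    linarith [Int.floor_le (2 ^ n * y)]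
  have h2 : ⌊2 ^ (n + 1) * y⌋ < 2 * ⌊2 ^ n * y⌋ + 2 := by
    rw [Int.floor_lt]
    push_cast
    rw [pow_succ]
    linarith [Int.lt_floor_add_one (2 ^ n * y)]
  omega

theorem floor_pow_mul_eq (n : ℕ) (y : ℝ) :
    ⌊2 ^ n * y⌋ = ⌊2 ^ n * Int.fract y⌋ + 2 ^ n * ⌊y⌋ := by
  have : (2 : ℝ) ^ n * y = 2 ^ n * Int.fract y + ((2 ^ n * ⌊y⌋ : ℤ) : ℝ) := by
    push_cast
    rw [← mul_add, Int.fract_add_floor]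
  rw [this, Int.floor_add_intCast]

theorem floor_pow_mul_emod (n : ℕ) (y : ℝ) :
    ⌊2 ^ n * y⌋ % 2 ^ n = ⌊2 ^ n * Int.fract y⌋ := by
  rw [floor_pow_mul_eq, Int.add_mul_emod_self_left, Int.emod_eq_of_lt]
  · exact Int.floor_nonneg.2 (mul_nonneg (by positivity) (Int.fract_nonneg y))
  · rw [Int.floor_lt]
    push_cast
    exact mul_lt_of_lt_one_right (by positivity) (Int.fract_lt_one y)

theorem emod_two_pow_div_mem (n : ℕ) (j : ℤ) :
    0 ≤ ((j % 2 ^ n : ℤ) : ℝ) / 2 ^ n ∧ ((j % 2 ^ n : ℤ) : ℝ) / 2 ^ n + 1 / 2 ^ n ≤ 1 := by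
  have h0 : 0 ≤ j % 2 ^ n := Int.emod_nonneg _ (by positivity)
  have h1 : j % 2 ^ n + 1 ≤ 2 ^ n := Int.emod_lt_of_pos _ (by positivity)
  constructor
  · have : (0 : ℝ) ≤ ((j % 2 ^ n : ℤ) : ℝ) := by exact_mod_cast h0
    positivity
  · rw [← add_div, div_le_one (by positivity)]
    exact_mod_cast h1

theorem isDyadicT_emod (n : ℕ) (j : ℤ) :
    IsDyadicT (((j % 2 ^ n : ℤ) : ℝ) / 2 ^ n) (1 / 2 ^ n) := by
  have h0 : 0 ≤ j % 2 ^ n := Int.emod_nonneg _ (by positivity)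
  have h1 : j % 2 ^ n < 2 ^ n := Int.emod_lt_of_pos _ (by positivity)
  rcases Nat.eq_zero_or_pos n with rfl | hn
  · left
    simp
  · right
    refine ⟨n, (j % 2 ^ n).toNat, hn, by zify; rwa [Int.toNat_of_nonneg h0], ?_, rfl⟩
    congr 1
    exact_mod_cast (Int.toNat_of_nonneg h0).symm

section Mean

variable {f : ℝ → ℝ}

theorem intervalIntegrable_dyadic (hf : IntegrableOn f (Icc 0 1)) (n : ℕ) (j : ℤ) :
    IntervalIntegrable f volume (((j % 2 ^ n : ℤ) : ℝ) / 2 ^ n)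
      (((j % 2 ^ n : ℤ) : ℝ) / 2 ^ n + 1 / 2 ^ n) := by
  obtain ⟨h0, h1⟩ := emod_two_pow_div_mem n j
  have hle : (((j % 2 ^ n : ℤ) : ℝ) / 2 ^ n) ≤ ((j % 2 ^ n : ℤ) : ℝ) / 2 ^ n + 1 / 2 ^ n :=
    le_add_of_nonneg_right (by positivity)
  rw [intervalIntegrable_iff_integrableOn_Icc_of_le hle]
  exact hf.mono_set (Icc_subset_Icc h0 h1)

theorem dyadicMean_child_left (n : ℕ) (j : ℤ) : dyadicMean f (n + 1) (2 * j) =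
    avgT f (((j % 2 ^ n : ℤ) : ℝ) / 2 ^ n) (1 / 2 ^ n / 2) := by
  have h : (2 * j) % 2 ^ (n + 1) = 2 * (j % 2 ^ n) := by
    rw [pow_succ', Int.mul_emod_mul_of_pos _ _ two_pos]
  rw [dyadicMean, h]
  congr 1
  · push_cast; field_simp; ring
  · field_simp; ring

theorem dyadicMean_child_right (n : ℕ) (j : ℤ) : dyadicMean f (n + 1) (2 * j + 1) =
    avgT f (((j % 2 ^ n : ℤ) : ℝ) / 2 ^ n + 1 / 2 ^ n / 2) (1 / 2 ^ n / 2) := by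
  have h : (2 * j + 1) % 2 ^ (n + 1) = 2 * (j % 2 ^ n) + 1 := by
    have h0 : 0 ≤ j % 2 ^ n := Int.emod_nonneg _ (by positivity)
    have h1 : j % 2 ^ n < 2 ^ n := Int.emod_lt_of_pos _ (by positivity)
    have hj : 2 * j + 1 = 2 * (j % 2 ^ n) + 1 + 2 ^ (n + 1) * (j / 2 ^ n) := by
      rw [pow_succ']
      linarith [Int.emod_add_mul_ediv j (2 ^ n)]
    rw [hj, Int.add_mul_emod_self_left, Int.emod_eq_of_lt (by omega) (by rw [pow_succ']; omega)]
  rw [dyadicMean, h]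
  congr 1
  · push_cast; field_simp; ring
  · field_simp; ring

theorem dyadicMean_eq_half (hf : IntegrableOn f (Icc 0 1)) (n : ℕ) (j : ℤ) :
    dyadicMean f n j = (dyadicMean f (n + 1) (2 * j) + dyadicMean f (n + 1) (2 * j + 1)) / 2 := by
  rw [dyadicMean_child_left, dyadicMean_child_right, dyadicMean,
    avgT_eq_half (by positivity) (intervalIntegrable_dyadic hf n j)]

theorem haarLayer_eq (hf : IntegrableOn f (Icc 0 1)) (n : ℕ) (y : ℝ) :
    haarLayer f n y =
      dyadicMean f (n + 1) ⌊2 ^ (n + 1) * y⌋ - dyadicMean f n ⌊2 ^ n * y⌋ := by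
  set q := ⌊2 ^ n * y⌋ with hq
  have hfr : q % 2 ^ n = ⌊2 ^ n * Int.fract y⌋ := floor_pow_mul_emod n y
  have h0 : 0 ≤ q % 2 ^ n := Int.emod_nonneg _ (by positivity)
  have h1 : q % 2 ^ n < 2 ^ n := Int.emod_lt_of_pos _ (by positivity)
  have hI := intervalIntegrable_dyadic hf n q
  have hpos : (0 : ℝ) < 1 / 2 ^ n := by positivity
  have hcast : (((q % 2 ^ n).toNat : ℕ) : ℝ) = ((q % 2 ^ n : ℤ) : ℝ) := by
    exact_mod_cast Int.toNat_of_nonneg h0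
  have hfl := Int.floor_le (2 ^ n * Int.fract y)
  have hfl' := Int.lt_floor_add_one (2 ^ n * Int.fract y)
  rw [← hfr] at hfl hfl'
  have hz : ((q % 2 ^ n : ℤ) : ℝ) / 2 ^ n ≤ Int.fract y := by
    rw [div_le_iff₀ (by positivity)]; linarith
  have hz' : Int.fract y < ((q % 2 ^ n : ℤ) : ℝ) / 2 ^ n + 1 / 2 ^ n := by
    rw [← add_div, lt_div_iff₀ (by positivity)]; linarith
  rw [haarLayer, Finset.sum_eq_single (q % 2 ^ n).toNat]
  · rw [hcast]
    have hmid : Int.fract y < ((q % 2 ^ n : ℤ) : ℝ) / 2 ^ n + 1 / 2 ^ n / 2 ↔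
        2 ^ (n + 1) * y < 2 * q + 1 := by
      have hq' : (q : ℝ) = ((q % 2 ^ n : ℤ) : ℝ) + 2 ^ n * ⌊y⌋ := by
        have := floor_pow_mul_eq n y
        rw [← hq] at this
        rw [← hfr] at this
        exact_mod_cast this
      have e : ((q % 2 ^ n : ℤ) : ℝ) / 2 ^ n + 1 / 2 ^ n / 2 =
          (2 * ((q % 2 ^ n : ℤ) : ℝ) + 1) / 2 ^ (n + 1) := by
        field_simp; ring
      rw [e, lt_div_iff₀ (by positivity), hq', Int.fract, pow_succ]
      constructor <;> intro h <;> linarith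
    rcases floor_pow_succ n y with h | h
    · have hlt : 2 ^ (n + 1) * y < 2 * q + 1 := by
        have := Int.lt_floor_add_one (2 ^ (n + 1) * y)
        rw [h] at this
        push_cast at this
        exact this
      rw [haarCoef_mul_haarT_left hpos hI hz (hmid.2 hlt), h, ← hq, dyadicMean_child_left,
        dyadicMean]
    · have hge : ¬ 2 ^ (n + 1) * y < 2 * q + 1 := by
        have := Int.floor_le (2 ^ (n + 1) * y)
        rw [h] at this
        push_cast at this
        exact this.not_gt
      rw [haarCoef_mul_haarT_right hpos hI (not_lt.1 (mt hmid.1 hge)) hz', h, ← hq,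
        dyadicMean_child_right, dyadicMean]
  · intro j _ hne
    rw [haarT_eq_zero hpos, mul_zero]
    have hne' : (j : ℤ) ≠ q % 2 ^ n := fun h => hne (by omega)
    rcases lt_or_gt_of_ne hne' with h | h
    · right
      have : (j : ℝ) + 1 ≤ ((q % 2 ^ n : ℤ) : ℝ) := by exact_mod_cast h
      refine le_trans ?_ hz
      rw [← add_div]
      gcongr
    · left
      have : ((q % 2 ^ n : ℤ) : ℝ) + 1 ≤ (j : ℝ) := by exact_mod_cast h
      refine hz'.trans_le ?_
      rw [← add_div]
      gcongr
  · intro h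
    refine absurd (Finset.mem_range.2 ?_) h
    zify
    rwa [Int.toNat_of_nonneg h0]

theorem sum_haarLayer_eq (hf : IntegrableOn f (Icc 0 1)) (n m : ℕ) (y : ℝ) :
    ∑ i ∈ Finset.range m, haarLayer f (n + i) y =
      dyadicMean f (n + m) ⌊2 ^ (n + m) * y⌋ - dyadicMean f n ⌊2 ^ n * y⌋ := by
  rw [Finset.sum_congr rfl fun i _ => haarLayer_eq hf (n + i) y]
  exact Finset.sum_range_sub (fun i => dyadicMean f (n + i) ⌊2 ^ (n + i) * y⌋) m

theorem abs_dyadicMean_sub_le (hf : IntegrableOn f (Icc 0 1)) (c : ℝ) (n : ℕ) (j : ℤ) :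
    |dyadicMean f n j - c| ≤ dyadicMean (fun x => |f x - c|) n j := by
  have hI := intervalIntegrable_dyadic hf n j
  rw [dyadicMean, dyadicMean, avgT, avgT]
  set a := ((j % 2 ^ n : ℤ) : ℝ) / 2 ^ n
  have hℓ : (0 : ℝ) < 1 / 2 ^ n := by positivity
  generalize (1 : ℝ) / 2 ^ n = ℓ at *
  have : 1 / ℓ * (∫ x in a..(a + ℓ), f x) - c = 1 / ℓ * ∫ x in a..(a + ℓ), (f x - c) := by
    rw [intervalIntegral.integral_sub hI intervalIntegrable_const, intervalIntegral.integral_const,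
      smul_eq_mul]
    field_simp
    ring
  rw [this, abs_mul, abs_of_pos (by positivity : 0 < 1 / ℓ)]
  gcongr
  exact intervalIntegral.abs_integral_le_integral_abs (by linarith)

end Mean

section Oscillation

variable {f : ℝ → ℝ} {B : ℝ}

theorem treeMean_dyadicMean_le (hf : IntegrableOn f (Icc 0 1))
    (hB : ∀ a ℓ : ℝ, IsDyadicT a ℓ → avgT (fun x => |f x - avgT f a ℓ|) a ℓ ≤ B)
    (m n : ℕ) (j : ℤ) :
    treeMean (dyadicMean f) (fun u => |u - dyadicMean f n j|) m n j ≤ B := by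
  have hg : IntegrableOn (fun x => |f x - dyadicMean f n j|) (Icc 0 1) :=
    (hf.sub (integrableOn_const (by simp))).abs
  exact (treeMean_abs_le (dyadicMean_eq_half hg) (abs_dyadicMean_sub_le hf _) m n j).trans
    (hB _ _ (isDyadicT_emod n j))

theorem abs_haarLayer_le (hf : IntegrableOn f (Icc 0 1))
    (hB : ∀ a ℓ : ℝ, IsDyadicT a ℓ → avgT (fun x => |f x - avgT f a ℓ|) a ℓ ≤ B)
    (n : ℕ) (y : ℝ) : |haarLayer f n y| ≤ B := by
  rw [haarLayer_eq hf]
  generalize hq : ⌊2 ^ n * y⌋ = q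
  have h := treeMean_dyadicMean_le hf hB 1 n q
  have h' := dyadicMean_eq_half hf n q
  simp only [treeMean] at h
  have hneg : dyadicMean f (n + 1) (2 * q + 1) - dyadicMean f n q =
      -(dyadicMean f (n + 1) (2 * q) - dyadicMean f n q) := by linarith
  rw [hneg, abs_neg] at h
  rcases floor_pow_succ n y with hk | hk <;> rw [hk, hq]
  · linarith
  · rw [hneg, abs_neg]
    linarith

theorem abs_haarLayer_sub_le (hf : IntegrableOn f (Icc 0 1))
    (hB : ∀ a ℓ : ℝ, IsDyadicT a ℓ → avgT (fun x => |f x - avgT f a ℓ|) a ℓ ≤ B)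
    (n : ℕ) {y z : ℝ} (hyz : y ≤ z) :
    |haarLayer f n z - haarLayer f n y| ≤
      2 * B * ((⌊2 ^ (n + 1) * z⌋ : ℝ) - ⌊2 ^ (n + 1) * y⌋) := by
  have hz := abs_haarLayer_le hf hB n z
  have hy := abs_haarLayer_le hf hB n y
  have hB0 : 0 ≤ B := (abs_nonneg _).trans hz
  have hle : ⌊2 ^ (n + 1) * y⌋ ≤ ⌊2 ^ (n + 1) * z⌋ := Int.floor_le_floor (by gcongr)
  rcases hle.eq_or_lt with h | h
  · have h' : ⌊2 ^ n * y⌋ = ⌊2 ^ n * z⌋ := by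
      have := floor_pow_succ n y
      have := floor_pow_succ n z
      omega
    rw [haarLayer_eq hf, haarLayer_eq hf, h, h']
    simp
  · have : (1 : ℝ) ≤ (⌊2 ^ (n + 1) * z⌋ : ℝ) - ⌊2 ^ (n + 1) * y⌋ := by
      have : (⌊2 ^ (n + 1) * y⌋ : ℝ) + 1 ≤ ⌊2 ^ (n + 1) * z⌋ := by exact_mod_cast h
      linarith
    calc |haarLayer f n z - haarLayer f n y| ≤ |haarLayer f n z| + |haarLayer f n y| := abs_sub _ _
      _ ≤ 2 * B * 1 := by linarith
      _ ≤ _ := by gcongr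

/-- Quadratic mean bound for the partial sums of the Haar expansion between two scales over an
arbitrary interval of length comparable to the coarser scale. -/
theorem lintegral_sum_haarLayer_sq_le (hB0 : 0 < B) (hf : IntegrableOn f (Icc 0 1))
    (hB : ∀ a ℓ : ℝ, IsDyadicT a ℓ → avgT (fun x => |f x - avgT f a ℓ|) a ℓ ≤ B)
    (n m : ℕ) {b ℓ : ℝ} (h1 : 1 / 2 ^ n ≤ ℓ) (h2 : ℓ ≤ 2 / 2 ^ n) :
    ∫⁻ y in Icc b (b + ℓ),
      ENNReal.ofReal ((∑ i ∈ Finset.range m, haarLayer f (n + i) y) ^ 2) ≤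
      ENNReal.ofReal (54 * B ^ 2 * ℓ) := by
  set F : ℝ → ENNReal :=
    fun y => ENNReal.ofReal ((∑ i ∈ Finset.range m, haarLayer f (n + i) y) ^ 2) with hF
  have hpiece : ∀ k : ℤ, ∫⁻ y in Ico ((k : ℝ) / 2 ^ n) ((k + 1) / 2 ^ n), F y ≤
      ENNReal.ofReal (18 * B ^ 2 * ℓ) := by
    intro k
    have hc : ∀ y ∈ Ico ((k : ℝ) / 2 ^ n) ((k + 1) / 2 ^ n), F y =
        ENNReal.ofReal ((dyadicMean f (n + m) ⌊2 ^ (n + m) * y⌋ - dyadicMean f n k) ^ 2) := by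
      intro y hy
      have hk : ⌊2 ^ n * y⌋ = k := by
        rw [Int.floor_eq_iff]
        rw [mem_Ico, div_le_iff₀ (by positivity), lt_div_iff₀ (by positivity)] at hy
        constructor <;> linarith [hy.1, hy.2]
      simp only [hF]
      rw [sum_haarLayer_eq hf, hk]
    rw [setLIntegral_congr_fun measurableSet_Ico hc]
    refine ((lintegral_treeMean (g := fun u => (u - dyadicMean f n k) ^ 2)
      (fun u => sq_nonneg _) m n k).2).trans (ENNReal.ofReal_le_ofReal ?_)
    have hs := treeMean_sq_le hB0 (dyadicMean_eq_half hf) (treeMean_dyadicMean_le hf hB) m n k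
    calc _ = treeMean (dyadicMean f) (fun u => (u - dyadicMean f n k) ^ 2) m n k *
          (1 / 2 ^ n) := by ring
      _ ≤ 18 * B ^ 2 * (1 / 2 ^ n) := by gcongr
      _ ≤ 18 * B ^ 2 * ℓ := by gcongr
  set k := ⌊2 ^ n * b⌋ with hk
  have hcover : Icc b (b + ℓ) ⊆ Ico ((k : ℝ) / 2 ^ n) ((k + 1) / 2 ^ n) ∪
      (Ico (((k + 1 : ℤ) : ℝ) / 2 ^ n) (((k + 1 : ℤ) + 1) / 2 ^ n) ∪
        Ico (((k + 2 : ℤ) : ℝ) / 2 ^ n) (((k + 2 : ℤ) + 1) / 2 ^ n)) := by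
    intro y hy
    have hkb := Int.floor_le (2 ^ n * b)
    have hkb' := Int.lt_floor_add_one (2 ^ n * b)
    rw [← hk] at hkb hkb'
    have hb1 : (k : ℝ) / 2 ^ n ≤ b := by
      rw [div_le_iff₀ (by positivity)]; linarith
    have hb2 : b < (k + 1) / 2 ^ n := by
      rw [lt_div_iff₀ (by positivity)]; linarith
    have hb3 : b + ℓ < (k + 2 + 1) / 2 ^ n := by
      have : ((k : ℝ) + 2 + 1) / 2 ^ n = (k + 1) / 2 ^ n + 2 / 2 ^ n := by ring
      linarith
    push_cast
    rcases lt_or_ge y ((k + 1) / 2 ^ n) with h | h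
    · exact Or.inl ⟨hb1.trans hy.1, h⟩
    rcases lt_or_ge y ((k + 1 + 1) / 2 ^ n) with h' | h'
    · exact Or.inr (Or.inl ⟨h, h'⟩)
    · refine Or.inr (Or.inr ⟨?_, hy.2.trans_lt hb3⟩)
      rwa [add_assoc, one_add_one_eq_two] at h'
  refine (lintegral_mono_set hcover).trans ((lintegral_union_le _ _ _).trans
    ((add_le_add (hpiece _) ((lintegral_union_le _ _ _).trans
      (add_le_add (hpiece _) (hpiece _)))).trans ?_))
  have hℓ : 0 ≤ ℓ := le_trans (by positivity) h1
  rw [← ENNReal.ofReal_add (by positivity) (by positivity),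
    ← ENNReal.ofReal_add (by positivity) (by positivity)]
  apply le_of_eq
  congr 1
  ring

end Oscillation

theorem intervalIntegrable_floor (M : ℕ) (v : ℝ) :
    IntervalIntegrable (fun t : ℝ => (⌊(M : ℝ) * (v + t)⌋ : ℝ)) volume 0 1 := by
  apply MonotoneOn.intervalIntegrable
  intro s _ t _ hst
  have : ⌊(M : ℝ) * (v + s)⌋ ≤ ⌊(M : ℝ) * (v + t)⌋ := Int.floor_le_floor (by gcongr)
  exact Int.cast_le.2 this

theorem integral_floor_sub (M : ℕ) (u v : ℝ) :
    ∫ t in (0 : ℝ)..1, ((⌊(M : ℝ) * (v + t)⌋ : ℝ) - ⌊(M : ℝ) * (u + t)⌋) = M * (v - u) := by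
  have hlin : ∀ w : ℝ, IntervalIntegrable (fun t : ℝ => (M : ℝ) * (w + t)) volume 0 1 :=
    fun w => (by fun_prop : Continuous fun t : ℝ => (M : ℝ) * (w + t)).intervalIntegrable _ _
  have hper : Function.Periodic (fun t : ℝ => Int.fract ((M : ℝ) * t)) 1 := by
    intro t
    simp only [mul_add, mul_one, Int.fract_add_natCast]
  have hfr : ∀ w : ℝ, ∫ t in (0 : ℝ)..1, Int.fract ((M : ℝ) * (w + t)) =
      ∫ t in (0 : ℝ)..1, Int.fract ((M : ℝ) * t) := by
    intro w
    rw [intervalIntegral.integral_comp_add_left (fun t => Int.fract ((M : ℝ) * t)) w, add_zero,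
      hper.intervalIntegral_add_eq w 0, zero_add]
  have hfl : ∀ w : ℝ, ∫ t in (0 : ℝ)..1, (⌊(M : ℝ) * (w + t)⌋ : ℝ) =
      M * w + M / 2 - ∫ t in (0 : ℝ)..1, Int.fract ((M : ℝ) * t) := by
    intro w
    have h : ∫ t in (0 : ℝ)..1, (M : ℝ) * (w + t) = M * w + M / 2 := by
      rw [intervalIntegral.integral_const_mul, intervalIntegral.integral_add
        intervalIntegrable_const (by simp), intervalIntegral.integral_const, integral_id]
      simp
      ring
    have hi : IntervalIntegrable (fun t : ℝ => Int.fract ((M : ℝ) * (w + t))) volume 0 1 :=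
      (hlin w).sub (intervalIntegrable_floor M w)
    rw [← h, ← hfr w, ← intervalIntegral.integral_sub (hlin w) hi]
    simp only [Int.self_sub_fract]
  rw [intervalIntegral.integral_sub (intervalIntegrable_floor M v) (intervalIntegrable_floor M u),
    hfl, hfl]
  ring

theorem measurable_haarT (a ℓ : ℝ) : Measurable (haarT a ℓ) := by
  refine Measurable.ite ?_ measurable_const (Measurable.ite ?_ measurable_const measurable_const)
  · exact measurableSet_Ico
  · exact measurableSet_Ico

theorem measurable_haarLayer {φ : ℝ → ℝ → ℝ} (hφ : Measurable fun q : ℝ × ℝ => φ q.1 q.2)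
    (n : ℕ) : Measurable fun q : ℝ × ℝ => haarLayer (φ q.1) n (q.2 + q.1) := by
  refine Finset.measurable_sum _ fun j _ => Measurable.mul ?_ ?_
  · have hle : (j : ℝ) / 2 ^ n ≤ (j : ℝ) / 2 ^ n + 1 / 2 ^ n :=
      le_add_of_nonneg_right (by positivity)
    simp only [haarCoef, intervalIntegral.integral_of_le hle]
    have h : Measurable fun q : ℝ × ℝ => φ q.1 q.2 * haarT (j / 2 ^ n) (1 / 2 ^ n) q.2 :=
      hφ.mul ((measurable_haarT _ _).comp measurable_snd)
    exact (h.stronglyMeasurable.integral_prod_right'.measurable).comp measurable_fst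
  · exact (measurable_haarT _ _).comp (measurable_fract.comp (measurable_snd.add measurable_fst))

theorem exists_one_div_two_pow_lt {ℓ : ℝ} (h0 : 0 < ℓ) (h1 : ℓ ≤ 1) :
    ∃ n : ℕ, 1 / 2 ^ n ≤ ℓ ∧ ℓ ≤ 2 / 2 ^ n ∧ ∀ k : ℕ, 1 / 2 ^ k < ℓ ↔ n ≤ k := by
  have hex : ∃ n : ℕ, (1 : ℝ) / 2 ^ n < ℓ := by
    obtain ⟨n, hn⟩ := exists_pow_lt_of_lt_one h0 (by norm_num : (1 / 2 : ℝ) < 1)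
    exact ⟨n, by rwa [one_div_pow] at hn⟩
  classical
  have hiff : ∀ k : ℕ, 1 / 2 ^ k < ℓ ↔ Nat.find hex ≤ k := by
    intro k
    refine ⟨fun h => Nat.find_min' hex h, fun h => lt_of_le_of_lt ?_ (Nat.find_spec hex)⟩
    gcongr
    norm_num
  refine ⟨Nat.find hex, (Nat.find_spec hex).le, ?_, hiff⟩
  have hpos : Nat.find hex ≠ 0 := by
    intro h
    have := Nat.find_spec hex
    rw [h] at this
    norm_num at this
    linarith
  obtain ⟨k, hk⟩ := Nat.exists_eq_succ_of_ne_zero hpos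
  have := mt (hiff k).1 (by omega)
  rw [hk, Nat.succ_eq_add_one, pow_succ]
  refine (not_lt.1 this).trans (le_of_eq ?_)
  field_simp

section Family

variable {φ : ℝ → ℝ → ℝ} {B : ℝ}

theorem intervalIntegrable_haarLayer (hφ : Measurable fun q : ℝ × ℝ => φ q.1 q.2)
    (hf : ∀ t ∈ Icc (0 : ℝ) 1, IntegrableOn (φ t) (Icc 0 1))
    (hB : ∀ t ∈ Icc (0 : ℝ) 1, ∀ a ℓ : ℝ, IsDyadicT a ℓ →
      avgT (fun x => |φ t x - avgT (φ t) a ℓ|) a ℓ ≤ B) (n : ℕ) (x : ℝ) :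
    IntervalIntegrable (fun t => haarLayer (φ t) n (x + t)) volume 0 1 := by
  rw [intervalIntegrable_iff_integrableOn_Icc_of_le zero_le_one]
  have hm : Measurable fun t => haarLayer (φ t) n (x + t) :=
    (measurable_haarLayer hφ n).comp (measurable_id.prodMk measurable_const)
  refine Measure.integrableOn_of_bounded (M := B) (by simp) hm.aestronglyMeasurable ?_
  filter_upwards [ae_restrict_mem measurableSet_Icc] with t ht
  exact abs_haarLayer_le (hf t ht) (hB t ht) n _

theorem phiB_eq_sum (hφ : Measurable fun q : ℝ × ℝ => φ q.1 q.2)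
    (hf : ∀ t ∈ Icc (0 : ℝ) 1, IntegrableOn (φ t) (Icc 0 1))
    (hB : ∀ t ∈ Icc (0 : ℝ) 1, ∀ a ℓ : ℝ, IsDyadicT a ℓ →
      avgT (fun x => |φ t x - avgT (φ t) a ℓ|) a ℓ ≤ B) {ℓ : ℝ} {n : ℕ}
    (hn : ∀ k : ℕ, 1 / 2 ^ k < ℓ ↔ n ≤ k) (x : ℝ) :
    phiB φ ℓ x = ∑ k ∈ Finset.range n, ∫ t in (0 : ℝ)..1, haarLayer (φ t) k (x + t) := by
  rw [← intervalIntegral.integral_finsetSum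
    fun k _ => intervalIntegrable_haarLayer hφ hf hB k x, phiB]
  congr 1
  funext t
  rw [tsum_eq_sum (s := Finset.range n)]
  · refine Finset.sum_congr rfl fun k hk => if_pos ?_
    rw [Finset.mem_range] at hk
    exact not_lt.1 (mt (hn k).1 hk.not_ge)
  · intro k hk
    rw [Finset.mem_range, not_lt] at hk
    exact if_neg ((hn k).2 hk).not_ge

theorem abs_phiB_sub_le (hφ : Measurable fun q : ℝ × ℝ => φ q.1 q.2)
    (hf : ∀ t ∈ Icc (0 : ℝ) 1, IntegrableOn (φ t) (Icc 0 1))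
    (hB0 : 0 ≤ B)
    (hB : ∀ t ∈ Icc (0 : ℝ) 1, ∀ a ℓ : ℝ, IsDyadicT a ℓ →
      avgT (fun x => |φ t x - avgT (φ t) a ℓ|) a ℓ ≤ B) {ℓ : ℝ} (h0 : 0 < ℓ) (h1 : ℓ ≤ 1)
    {u v : ℝ} (huv : u ≤ v) (hvu : v - u ≤ ℓ) :
    |phiB φ ℓ v - phiB φ ℓ u| ≤ 8 * B := by
  obtain ⟨n, -, hn2, hn⟩ := exists_one_div_two_pow_lt h0 h1
  rw [phiB_eq_sum hφ hf hB hn, phiB_eq_sum hφ hf hB hn, ← Finset.sum_sub_distrib]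
  have hterm : ∀ k : ℕ, |(∫ t in (0 : ℝ)..1, haarLayer (φ t) k (v + t)) -
      ∫ t in (0 : ℝ)..1, haarLayer (φ t) k (u + t)| ≤ 2 ^ k * (4 * B * ℓ) := by
    intro k
    have hfl := (intervalIntegrable_floor (2 ^ (k + 1)) v).sub
      (intervalIntegrable_floor (2 ^ (k + 1)) u)
    rw [← intervalIntegral.integral_sub (intervalIntegrable_haarLayer hφ hf hB k v)
      (intervalIntegrable_haarLayer hφ hf hB k u)]
    have hle := intervalIntegral.norm_integral_le_of_norm_le (μ := volume)
      (f := fun t => haarLayer (φ t) k (v + t) - haarLayer (φ t) k (u + t))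
      (zero_le_one (α := ℝ)) (ae_of_all _ fun t ht => ?_) (hfl.const_mul (2 * B))
    · rw [Real.norm_eq_abs] at hle
      refine hle.trans ?_
      rw [intervalIntegral.integral_const_mul, integral_floor_sub]
      push_cast
      rw [pow_succ]
      calc 2 * B * (2 ^ k * 2 * (v - u)) ≤ 2 * B * (2 ^ k * 2 * ℓ) := by gcongr
        _ = 2 ^ k * (4 * B * ℓ) := by ring
    · have ht' : t ∈ Icc (0 : ℝ) 1 := ⟨ht.1.le, ht.2⟩
      have := abs_haarLayer_sub_le (hf t ht') (hB t ht') k (add_le_add_left huv t)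
      push_cast
      exact this
  calc _ ≤ ∑ k ∈ Finset.range n, 2 ^ k * (4 * B * ℓ) :=
        (Finset.abs_sum_le_sum_abs _ _).trans (Finset.sum_le_sum fun k _ => hterm k)
    _ = (2 ^ n - 1) * (4 * B * ℓ) := by
        rw [← Finset.sum_mul, geom_sum_eq (by norm_num)]
        norm_num
    _ ≤ 2 ^ n * (4 * B * ℓ) := by
        gcongr
        linarith
    _ ≤ 2 ^ n * (4 * B * (2 / 2 ^ n)) := by gcongr
    _ = 8 * B := by
        field_simp
        ring

theorem enorm_tsum_le_liminf (n : ℕ) (d : ℕ → ℝ) :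
    ‖∑' k, if n ≤ k then d k else 0‖ₑ ≤
      Filter.liminf (fun m => ‖∑ i ∈ Finset.range m, d (n + i)‖ₑ) Filter.atTop := by
  by_cases hs : Summable fun k => if n ≤ k then d k else 0
  · have ht := (Filter.tendsto_add_atTop_iff_nat n).2 hs.hasSum.tendsto_sum_nat
    have heq : ∀ m, ∑ k ∈ Finset.range (m + n), (if n ≤ k then d k else 0) =
        ∑ i ∈ Finset.range m, d (n + i) := by
      intro m
      rw [add_comm m n, Finset.sum_range_add, Finset.sum_eq_zero, zero_add]
      · simp
      · intro k hk
        exact if_neg (Finset.mem_range.1 hk).not_ge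
    simp only [heq] at ht
    exact ht.enorm.liminf_eq.ge
  · rw [tsum_eq_zero_of_not_summable hs]
    simp

theorem lintegral_phiA_sq_le (hφ : Measurable fun q : ℝ × ℝ => φ q.1 q.2)
    (hf : ∀ t ∈ Icc (0 : ℝ) 1, IntegrableOn (φ t) (Icc 0 1))
    (hB0 : 0 < B)
    (hB : ∀ t ∈ Icc (0 : ℝ) 1, ∀ a ℓ : ℝ, IsDyadicT a ℓ →
      avgT (fun x => |φ t x - avgT (φ t) a ℓ|) a ℓ ≤ B) {ℓ : ℝ} (h0 : 0 < ℓ) (h1 : ℓ ≤ 1)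
    (a : ℝ) :
    ∫⁻ x in Icc a (a + ℓ), ‖phiA φ ℓ x‖ₑ ^ 2 ≤ ENNReal.ofReal (54 * B ^ 2 * ℓ) := by
  obtain ⟨n, hn1, hn2, hn⟩ := exists_one_div_two_pow_lt h0 h1
  let S : ℕ → ℝ × ℝ → ℝ :=
    fun m q => ∑ i ∈ Finset.range m, haarLayer (φ q.1) (n + i) (q.2 + q.1)
  have hS : ∀ m, Measurable (S m) :=
    fun m => Finset.measurable_sum _ fun i _ => measurable_haarLayer hφ _
  have hSx : ∀ m t, Measurable fun x => S m (t, x) :=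
    fun m t => (hS m).comp (measurable_const.prodMk measurable_id)
  have hG : Measurable fun q => Filter.liminf (fun m => ‖S m q‖ₑ) Filter.atTop :=
    Measurable.liminf fun m => (hS m).enorm
  have hpoint : ∀ x, ‖phiA φ ℓ x‖ₑ ^ 2 ≤
      ∫⁻ t in Ioc (0 : ℝ) 1, (Filter.liminf (fun m => ‖S m (t, x)‖ₑ) Filter.atTop) ^ 2 := by
    intro x
    have hle : ‖phiA φ ℓ x‖ₑ ≤
        ∫⁻ t in Ioc (0 : ℝ) 1, Filter.liminf (fun m => ‖S m (t, x)‖ₑ) Filter.atTop := by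
      rw [phiA, intervalIntegral.integral_of_le zero_le_one]
      refine (enorm_integral_le_lintegral_enorm _).trans (lintegral_mono fun t => ?_)
      simp only [hn]
      exact enorm_tsum_le_liminf n fun k => haarLayer (φ t) k (x + t)
    have hGx : Measurable fun t => Filter.liminf (fun m => ‖S m (t, x)‖ₑ) Filter.atTop :=
      hG.comp (measurable_id.prodMk measurable_const)
    have hH := ENNReal.lintegral_mul_le_Lp_mul_Lq (volume.restrict (Ioc (0 : ℝ) 1))
      Real.HolderConjugate.two_two hGx.aemeasurable (aemeasurable_const (b := (1 : ENNReal)))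
    simp only [Pi.mul_apply, mul_one, ENNReal.one_rpow, lintegral_const, Measure.restrict_apply,
      MeasurableSet.univ, univ_inter, Real.volume_Ioc, sub_zero, ENNReal.ofReal_one,
      ENNReal.rpow_two, one_pow] at hH
    calc _ ≤ _ := pow_le_pow_left' (hle.trans hH) 2
      _ = _ := by
        rw [← ENNReal.rpow_two, ← ENNReal.rpow_mul]
        norm_num
  have hsq : ∀ q, (Filter.liminf (fun m => ‖S m q‖ₑ) Filter.atTop) ^ 2 =
      Filter.liminf (fun m => ‖S m q‖ₑ ^ 2) Filter.atTop := by
    intro q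
    have hmono : Monotone fun u : ENNReal => u ^ 2 := fun u v h => pow_le_pow_left' h 2
    exact hmono.map_liminf_of_continuousAt _ (ENNReal.continuous_pow 2).continuousAt
  calc _ ≤ ∫⁻ x in Icc a (a + ℓ), ∫⁻ t in Ioc (0 : ℝ) 1,
          (Filter.liminf (fun m => ‖S m (t, x)‖ₑ) Filter.atTop) ^ 2 := lintegral_mono hpoint
    _ = ∫⁻ t in Ioc (0 : ℝ) 1, ∫⁻ x in Icc a (a + ℓ),
          (Filter.liminf (fun m => ‖S m (t, x)‖ₑ) Filter.atTop) ^ 2 :=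
        lintegral_lintegral_swap ((hG.pow_const 2).comp measurable_swap).aemeasurable
    _ ≤ ∫⁻ _ in Ioc (0 : ℝ) 1, ENNReal.ofReal (54 * B ^ 2 * ℓ) := by
        refine setLIntegral_mono measurable_const fun t ht => ?_
        have ht' : t ∈ Icc (0 : ℝ) 1 := ⟨ht.1.le, ht.2⟩
        simp only [hsq]
        refine (lintegral_liminf_le fun m => (hSx m t).enorm.pow_const 2).trans ?_
        refine Filter.liminf_le_of_le (by isBoundedDefault) fun b hb => ?_
        obtain ⟨m, hm⟩ := hb.exists
        refine hm.trans ?_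
        have htr := (measurePreserving_add_right volume t).setLIntegral_comp_preimage_emb
          (measurableEmbedding_addRight t)
          (fun y => ENNReal.ofReal ((∑ i ∈ Finset.range m, haarLayer (φ t) (n + i) y) ^ 2))
          (Icc (a + t) (a + t + ℓ))
        rw [preimage_add_const_Icc, add_sub_cancel_right,
          show a + t + ℓ - t = a + ℓ by ring] at htr
        have hle := lintegral_sum_haarLayer_sq_le hB0 (hf t ht') (hB t ht') n m hn1 hn2
          (b := a + t)
        rw [← htr] at hle
        refine le_trans (le_of_eq (lintegral_congr fun x => ?_)) hle
        rw [← enorm_pow, Real.enorm_of_nonneg (sq_nonneg _)]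
    _ = ENNReal.ofReal (54 * B ^ 2 * ℓ) := by simp

end Family

/-- **Lemma (estimates on `φ_A` and `φ_B`).** For a measurable family `{φ^t}` of mean-zero
dyadic `BMO` functions with `‖φ^t‖_d ≤ B`, there are constants `C_A`, `C_B` depending only
on `B` such that for every interval `Q = [a, a+ℓ]` of the circle and every `x₀ ∈ Q`,
`(1/|Q|)∫_Q |φ_A|² ≤ C_A` and `(1/|Q|)∫_Q |φ_B(x) − φ_B(x₀)| dx ≤ C_B`, where `φ_A`, `φ_B`
are the small- and large-scale parts of the translation-averaged Haar expansion. -/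
theorem phiA_phiB_estimates (B : ℝ) :
    ∃ C_A C_B : ℝ, ∀ φ : ℝ → ℝ → ℝ,
      -- (i) joint measurability of `(t,x) ↦ φ^t(x)`
      Measurable (fun q : ℝ × ℝ => φ q.1 q.2) →
      (∀ t ∈ Set.Icc (0:ℝ) 1, IntegrableOn (φ t) (Set.Icc (0:ℝ) 1)) →
      -- (ii) uniform dyadic BMO bound
      (∀ t ∈ Set.Icc (0:ℝ) 1, ∀ a ℓ : ℝ, IsDyadicT a ℓ →
        avgT (fun x => |φ t x - avgT (φ t) a ℓ|) a ℓ ≤ B) →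
      -- (iii) mean value zero
      (∀ t ∈ Set.Icc (0:ℝ) 1, ∫ x in (0:ℝ)..1, φ t x = 0) →
      ∀ a ℓ : ℝ, IsIntervalT a ℓ → ∀ x₀ ∈ Set.Icc a (a + ℓ),
        (1 / ℓ) * (∫ x in a..(a + ℓ), (phiA φ ℓ x) ^ 2) ≤ C_A ∧
        (1 / ℓ) * (∫ x in a..(a + ℓ), |phiB φ ℓ x - phiB φ ℓ x₀|) ≤ C_B := by
  refine ⟨54 * (|B| + 1) ^ 2, 8 * (|B| + 1), ?_⟩
  intro φ hφ hf hB _ a ℓ ⟨h0, h1⟩ x₀ hx₀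
  have hB0 : 0 < |B| + 1 := by positivity
  have hB' : ∀ t ∈ Icc (0 : ℝ) 1, ∀ a ℓ : ℝ, IsDyadicT a ℓ →
      avgT (fun x => |φ t x - avgT (φ t) a ℓ|) a ℓ ≤ |B| + 1 :=
    fun t ht a ℓ h => (hB t ht a ℓ h).trans (by linarith [le_abs_self B])
  have hle : a ≤ a + ℓ := by linarith
  constructor
  · have hA := lintegral_phiA_sq_le hφ hf hB0 hB' h0 h1 a
    have hI : ‖∫ x in a..(a + ℓ), (phiA φ ℓ x) ^ 2‖ₑ ≤
        ENNReal.ofReal (54 * (|B| + 1) ^ 2 * ℓ) := by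
      rw [intervalIntegral.integral_of_le hle, ← integral_Icc_eq_integral_Ioc]
      refine (enorm_integral_le_lintegral_enorm _).trans ?_
      simpa only [enorm_pow] using hA
    rw [← ofReal_norm, ENNReal.ofReal_le_ofReal_iff (by positivity)] at hI
    rw [one_div_mul_eq_div, div_le_iff₀ h0]
    exact (le_abs_self _).trans hI
  · have hpt : ∀ x ∈ Icc a (a + ℓ), |phiB φ ℓ x - phiB φ ℓ x₀| ≤ 8 * (|B| + 1) := by
      intro x hx
      rcases le_total x₀ x with h | h
      · exact abs_phiB_sub_le hφ hf hB0.le hB' h0 h1 h (by linarith [hx.2, hx₀.1])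
      · rw [abs_sub_comm]
        exact abs_phiB_sub_le hφ hf hB0.le hB' h0 h1 h (by linarith [hx.1, hx₀.2])
    have hI := intervalIntegral.norm_integral_le_of_norm_le_const (a := a) (b := a + ℓ)
      (f := fun x => |phiB φ ℓ x - phiB φ ℓ x₀|) (C := 8 * (|B| + 1)) fun x hx => by
        rw [uIoc_of_le hle] at hx
        rw [Real.norm_eq_abs, abs_abs]
        exact hpt x ⟨hx.1.le, hx.2⟩
    rw [add_sub_cancel_left, abs_of_pos h0] at hI
    rw [one_div_mul_eq_div, div_le_iff₀ h0]
    exact (le_abs_self _).trans hI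
end
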